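/- Let H be an N×N hermitian Wigner matrix satisfying condition C1, let κ > 0 and fix an energy E ∈ [−2+κ, 2−κ]. Then there exist positive constants C, c depending only on κ (and on the constants in C1) and a universal constant c₁ > 0 such that for every δ ≤ c₁κ, every N ≥ 2, and every η with K/N ≤ η ≤ 1, where K = 300/c₀ and c₀ = π ρ_sc(E), one has P( |m(E+iη) − m_sc(E+iη)| ≥ δ ) ≤ C e^{−c δ √(Nη)}. -/

import Mathlib

open MeasureTheory ProbabilityTheory
open scoped ENNReal NNReal

noncomputable section

/-- The density of the Wigner semicircle law. -/
def rhoSC (x : ℝ) : ℝ := if |x| ≤ 2 then Real.sqrt (4 - x ^ 2) / (2 * Real.pi) else 0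

/-- The Stieltjes transform of the Wigner semicircle law. -/
def mSC (z : ℂ) : ℂ := ∫ x : ℝ, (rhoSC x : ℂ) / ((x : ℂ) - z)

/-- The Stieltjes transform of the empirical eigenvalue distribution of a matrix:
`m(z) = N⁻¹ Tr (H - z)⁻¹`. -/
def stTrans {N : ℕ} (A : Matrix (Fin N) (Fin N) ℂ) (z : ℂ) : ℂ :=
  (Matrix.trace (A - z • (1 : Matrix (Fin N) (Fin N) ℂ))⁻¹) / (N : ℂ)

open scoped Classical in
/-- The number of eigenvalues (with multiplicity) of a Hermitian matrix lying in a set `I`. -/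
def eigCount {N : ℕ} {A : Matrix (Fin N) (Fin N) ℂ} (hA : A.IsHermitian) (I : Set ℝ) : ℕ :=
  (Finset.univ.filter fun i => hA.eigenvalues i ∈ I).card

/-- `ν` has a strictly positive density `h` on `ℝ² ≃ ℂ` which is either a product of two copies
of a one-variable function or radially symmetric. -/
def WignerDensityOf (ν : Measure ℂ) (h : ℝ → ℝ → ℝ) : Prop :=
  (∀ x y, 0 < h x y) ∧
  ν = (volume : Measure ℂ).withDensity (fun z => ENNReal.ofReal (h z.re z.im)) ∧
  ((∃ hs : ℝ → ℝ, ∀ x y, h x y = hs x * hs y) ∨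
   (∃ hs : ℝ → ℝ, ∀ x y, h x y = hs (x ^ 2 + y ^ 2)))

/-- Condition C1, with explicit constants: Gaussian moments of the off-diagonal law `ν`
and of the diagonal law `ν'` are bounded by `D` resp. `D'`. -/
def CondC1 (ν : Measure ℂ) (ν' : Measure ℝ) (δ₀ D D' : ℝ) : Prop :=
  0 < δ₀ ∧
  (∫⁻ z, ENNReal.ofReal (Real.exp (δ₀ * ‖z‖ ^ 2)) ∂ν) ≤ ENNReal.ofReal D ∧
  (∫⁻ x, ENNReal.ofReal (Real.exp (δ₀ * x ^ 2)) ∂ν') ≤ ENNReal.ofReal D'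

/-- `H` is an `N × N` hermitian Wigner ensemble on the probability space `(Ω, P)`:
the entries above the diagonal are i.i.d. with law `N^{-1/2} ν` where `ν` has mean zero,
variance one and a density as in `WignerDensityOf`; the diagonal entries are real i.i.d.
with law `N^{-1/2} ν'`, `ν'` of mean zero; and all these entries are independent. -/
structure IsWignerMatrix {Ω : Type} [MeasurableSpace Ω] (P : Measure Ω) (N : ℕ)
    (H : Ω → Matrix (Fin N) (Fin N) ℂ) (ν : Measure ℂ) (ν' : Measure ℝ) : Prop where
  herm : ∀ ω, (H ω).IsHermitian
  prob : IsProbabilityMeasure P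
  probν : IsProbabilityMeasure ν
  probν' : IsProbabilityMeasure ν'
  density : ∃ h, WignerDensityOf ν h
  mean : (∫ z, z ∂ν) = 0
  var : (∫ z, ‖z‖ ^ 2 ∂ν) = 1
  mean' : (∫ x, x ∂ν') = 0
  offdiag : ∀ i j : Fin N, i < j →
    P.map (fun ω => (Real.sqrt N : ℂ) * H ω i j) = ν
  diag : ∀ i : Fin N, P.map (fun ω => Real.sqrt N * (H ω i i).re) = ν'
  diag_real : ∀ ω i, (H ω i i).im = 0
  indep : iIndepFun
    (fun (p : {p : Fin N × Fin N // p.1 ≤ p.2}) (ω : Ω) => H ω p.1.1 p.1.2) P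
/-- The Fourier transform on `ℝ²` of a real function of two variables. -/
def fourier2 (f : ℝ → ℝ → ℝ) (t s : ℝ) : ℂ :=
  ∫ x : ℝ, ∫ y : ℝ, Complex.exp (-Complex.I * (t * x + s * y)) * (f x y : ℂ)

/-- The Laplacian of a function of two real variables. -/
def laplacian2 (g : ℝ → ℝ → ℝ) (x y : ℝ) : ℝ :=
  deriv (deriv (fun t => g t y)) x + deriv (deriv (fun t => g x t)) y

/-- Condition C2 with exponent `a` and constants `w`, `w'`: decay of the Fourier transforms
of the density `h` and of `h · Δ(-log h)`. -/
def CondC2 (h : ℝ → ℝ → ℝ) (a : ℕ) (w w' : ℝ) : Prop :=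
  0 < w ∧ 0 < w' ∧
  (∀ t s : ℝ, ‖fourier2 h t s‖ ≤ 1 / (1 + w * (t ^ 2 + s ^ 2)) ^ a) ∧
  (∀ t s : ℝ, ‖fourier2
      (fun x y => h x y * laplacian2 (fun u v => -Real.log (h u v)) x y) t s‖
    ≤ 1 / (1 + w' * (t ^ 2 + s ^ 2)) ^ a)

/-- Either the real and imaginary parts under `ν` are i.i.d., or `ν` is rotationally
symmetric. -/
def ComplexSymm (ν : Measure ℂ) : Prop :=
  (∃ μ₀ : Measure ℝ,
    ν = Measure.map (fun p : ℝ × ℝ => (p.1 : ℂ) + p.2 * Complex.I) (μ₀.prod μ₀)) ∨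
  (∀ θ : ℝ, Measure.map (fun z => Complex.exp (θ * Complex.I) * z) ν = ν)

open scoped Matrix ComplexConjugate


section Resolvent
variable {n : Type} [Fintype n] [DecidableEq n]

/-- resolvent -/
def rsv (A : Matrix n n ℂ) (z : ℂ) : Matrix n n ℂ := (A - z • (1 : Matrix n n ℂ))⁻¹

lemma ofReal_sub_ne (x : ℝ) {z : ℂ} (hz : 0 < z.im) : (x : ℂ) - z ≠ 0 := by
  intro h
  have := congrArg Complex.im h
  simp at this
  linarith

lemma spectral_rep {A : Matrix n n ℂ} (hA : A.IsHermitian) :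
    ∃ (l : n → ℝ) (w : n → n → ℝ), (∀ i a, 0 ≤ w i a) ∧ (∀ a, ∑ i, w i a = 1) ∧
      ∀ z : ℂ, 0 < z.im → (A - z • (1 : Matrix n n ℂ)) * rsv A z = 1 ∧
        rsv A z * (A - z • (1 : Matrix n n ℂ)) = 1 ∧
        ∀ i, rsv A z i i = ∑ a, (w i a : ℂ) * ((l a : ℂ) - z)⁻¹ := by
  set U : Matrix n n ℂ := (hA.eigenvectorUnitary : Matrix n n ℂ) with hU
  have h1 : U * Uᴴ = 1 := Unitary.coe_mul_star_self hA.eigenvectorUnitary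
  have h2 : Uᴴ * U = 1 := Unitary.coe_star_mul_self hA.eigenvectorUnitary
  have hs : A = U * Matrix.diagonal (fun a => ((hA.eigenvalues a : ℝ) : ℂ)) * Uᴴ := by
    have := hA.spectral_theorem
    rw [Unitary.conjStarAlgAut_apply] at this
    exact this
  refine ⟨hA.eigenvalues, fun i a => ‖U i a‖ ^ 2, fun i a => by positivity, fun a => ?_, ?_⟩
  · have := congrFun (congrFun h2 a) a
    simp only [Matrix.mul_apply, Matrix.conjTranspose_apply, Matrix.one_apply_eq] at this
    have h3 : ((∑ i, ‖U i a‖ ^ 2 : ℝ) : ℂ) = 1 := by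
      rw [← this]
      push_cast
      refine Finset.sum_congr rfl fun i _ => ?_
      rw [← Complex.conj_mul']
      rfl
    exact_mod_cast h3
  · intro z hz
    set D : Matrix n n ℂ := Matrix.diagonal (fun a => (((hA.eigenvalues a : ℝ) : ℂ) - z)⁻¹) with hD
    have e1 : A - z • (1 : Matrix n n ℂ) =
        U * Matrix.diagonal (fun a => ((hA.eigenvalues a : ℝ) : ℂ) - z) * Uᴴ := by
      have : Matrix.diagonal (fun a => ((hA.eigenvalues a : ℝ) : ℂ) - z) =
        Matrix.diagonal (fun a => ((hA.eigenvalues a : ℝ) : ℂ)) - z • (1 : Matrix n n ℂ) := by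
        ext i j
        by_cases h : i = j
        · subst h; simp
        · simp [h]
      rw [this, Matrix.mul_sub, Matrix.sub_mul, ← hs]
      simp [h1]
    have e2 : (A - z • (1 : Matrix n n ℂ)) * (U * D * Uᴴ) = 1 := by
      rw [e1]
      calc _ = U * (Matrix.diagonal (fun a => ((hA.eigenvalues a : ℝ) : ℂ) - z) * ((Uᴴ * U) * D)) * Uᴴ := by
            simp only [Matrix.mul_assoc]
        _ = 1 := by
            rw [h2, Matrix.one_mul, hD, Matrix.diagonal_mul_diagonal]
            have : (fun i => (((hA.eigenvalues i : ℝ) : ℂ) - z) * (((hA.eigenvalues i : ℝ) : ℂ) - z)⁻¹) = fun _ => 1 := by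
              funext i
              exact mul_inv_cancel₀ (ofReal_sub_ne _ hz)
            rw [this, Matrix.diagonal_one, Matrix.mul_one, h1]
    have e3 : rsv A z = U * D * Uᴴ := Matrix.inv_eq_right_inv e2
    refine ⟨by rw [e3]; exact e2, ?_, fun i => ?_⟩
    · rw [e3]; exact mul_eq_one_comm.mp e2
    · rw [e3, hD, Matrix.mul_apply]
      refine Finset.sum_congr rfl fun a _ => ?_
      rw [Matrix.mul_diagonal, Matrix.conjTranspose_apply]
      push_cast
      rw [← Complex.mul_conj']
      simp only [RCLike.star_def]
      ring

lemma rsv_mul {A : Matrix n n ℂ} (hA : A.IsHermitian) {z : ℂ} (hz : 0 < z.im) :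
    (A - z • (1 : Matrix n n ℂ)) * rsv A z = 1 ∧ rsv A z * (A - z • (1 : Matrix n n ℂ)) = 1 := by
  obtain ⟨l, w, _, _, h⟩ := spectral_rep hA
  exact ⟨(h z hz).1, (h z hz).2.1⟩

lemma rsv_conj {A : Matrix n n ℂ} (hA : A.IsHermitian) {z : ℂ} (hz : 0 < z.im) :
    (rsv A z)ᴴ * (A - conj z • (1 : Matrix n n ℂ)) = 1 ∧
    (A - conj z • (1 : Matrix n n ℂ)) * (rsv A z)ᴴ = 1 := by
  obtain ⟨h1, h2⟩ := rsv_mul hA hz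
  have e : (A - z • (1 : Matrix n n ℂ))ᴴ = A - conj z • (1 : Matrix n n ℂ) := by
    rw [Matrix.conjTranspose_sub, hA.eq, Matrix.conjTranspose_smul, Matrix.conjTranspose_one]; rfl
  constructor
  · rw [← e, ← Matrix.conjTranspose_mul, h1, Matrix.conjTranspose_one]
  · rw [← e, ← Matrix.conjTranspose_mul, h2, Matrix.conjTranspose_one]

lemma rsv_sub_conj {A : Matrix n n ℂ} (hA : A.IsHermitian) {z : ℂ} (hz : 0 < z.im) :
    rsv A z - (rsv A z)ᴴ = (z - conj z) • (rsv A z * (rsv A z)ᴴ) ∧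
    rsv A z - (rsv A z)ᴴ = (z - conj z) • ((rsv A z)ᴴ * rsv A z) := by
  obtain ⟨h1, h2⟩ := rsv_mul hA hz
  obtain ⟨h3, h4⟩ := rsv_conj hA hz
  have e : (z - conj z) • (1 : Matrix n n ℂ) =
      (A - conj z • (1 : Matrix n n ℂ)) - (A - z • (1 : Matrix n n ℂ)) := by
    rw [sub_smul]; abel
  constructor
  · calc rsv A z - (rsv A z)ᴴ = rsv A z * ((A - conj z • (1 : Matrix n n ℂ)) * (rsv A z)ᴴ)
          - (rsv A z * (A - z • (1 : Matrix n n ℂ))) * (rsv A z)ᴴ := by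
            rw [h4, h2, Matrix.mul_one, Matrix.one_mul]
      _ = rsv A z * ((z - conj z) • (1 : Matrix n n ℂ)) * (rsv A z)ᴴ := by
            rw [e]; noncomm_ring
      _ = _ := by simp
  · calc rsv A z - (rsv A z)ᴴ = ((rsv A z)ᴴ * (A - conj z • (1 : Matrix n n ℂ))) * rsv A z
          - (rsv A z)ᴴ * ((A - z • (1 : Matrix n n ℂ)) * rsv A z) := by
            rw [h3, h1, Matrix.mul_one, Matrix.one_mul]
      _ = (rsv A z)ᴴ * ((z - conj z) • (1 : Matrix n n ℂ)) * rsv A z := by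
            rw [e]; noncomm_ring
      _ = _ := by simp

lemma rsv_normal {A : Matrix n n ℂ} (hA : A.IsHermitian) {z : ℂ} (hz : 0 < z.im) :
    rsv A z * (rsv A z)ᴴ = (rsv A z)ᴴ * rsv A z := by
  obtain ⟨h1, h2⟩ := rsv_sub_conj hA hz
  have hne : z - conj z ≠ 0 := by
    rw [Complex.sub_conj]
    simp [hz.ne']
  exact smul_right_injective _ hne (h1.symm.trans h2)

/-- Ward identity -/
lemma ward {A : Matrix n n ℂ} (hA : A.IsHermitian) {z : ℂ} (hz : 0 < z.im) (i : n) :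
    (rsv A z i i).im = z.im * ∑ j, ‖rsv A z i j‖ ^ 2 := by
  have h := congrFun (congrFun (rsv_sub_conj hA hz).1 i) i
  have h5 : (rsv A z * (rsv A z)ᴴ) i i = ((∑ j, ‖rsv A z i j‖ ^ 2 : ℝ) : ℂ) := by
    rw [Matrix.mul_apply]
    push_cast
    refine Finset.sum_congr rfl fun j _ => ?_
    rw [Matrix.conjTranspose_apply, ← Complex.mul_conj']; rfl
  rw [Matrix.sub_apply, Matrix.smul_apply, h5, Matrix.conjTranspose_apply] at h
  generalize (∑ j, ‖rsv A z i j‖ ^ 2) = S at h ⊢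
  have h6 := congrArg Complex.im h
  simp at h6
  linarith

lemma rsv_diag_le {A : Matrix n n ℂ} (hA : A.IsHermitian) {z : ℂ} (hz : 0 < z.im) (i : n) :
    ‖rsv A z i i‖ ≤ 1 / z.im := by
  have h := ward hA hz i
  have h1 : ‖rsv A z i i‖ ^ 2 ≤ ∑ j, ‖rsv A z i j‖ ^ 2 :=
    Finset.single_le_sum (f := fun j => ‖rsv A z i j‖ ^ 2) (fun j _ => by positivity) (Finset.mem_univ i)
  have h2 := (Complex.abs_im_le_norm (rsv A z i i))
  have h3 := le_abs_self (rsv A z i i).im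
  rw [le_div_iff₀ hz]
  by_contra hc
  push Not at hc
  have : 0 < ‖rsv A z i i‖ := by
    by_contra h0
    have : ‖rsv A z i i‖ = 0 := le_antisymm (not_lt.mp h0) (norm_nonneg _)
    rw [this] at hc; linarith
  nlinarith

lemma inv_im (x : ℝ) {z : ℂ} : (((x : ℂ) - z)⁻¹).im = z.im / ((x - z.re) ^ 2 + z.im ^ 2) := by
  rw [Complex.inv_im, Complex.normSq_apply]
  simp
  ring_nf

lemma rep_scale {m : Type} [Fintype m] (w l : m → ℝ) (hw : ∀ a, 0 ≤ w a) (E η : ℝ) (hη : 0 < η)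
    (f : ℝ → ℂ) (hf : ∀ t, f t = ∑ a, (w a : ℂ) * ((l a : ℂ) - ((E : ℂ) + t * Complex.I))⁻¹) :
    ‖f η‖ ≤ 2 * ‖f (2 * η)‖ ∧ (f η).im ≤ 2 * (f (2 * η)).im ∧ (f (2 * η)).im ≤ 2 * (f η).im ∧
      0 ≤ (f η).im := by
  have him : ∀ t, (f t).im = ∑ a, w a * (t / ((l a - E) ^ 2 + t ^ 2)) := by
    intro t
    rw [hf, Complex.im_sum]
    refine Finset.sum_congr rfl fun a _ => ?_
    rw [Complex.im_ofReal_mul, inv_im]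
    simp
  have hq : ∀ (a : m) (t : ℝ), ‖((l a : ℂ) - ((E : ℂ) + t * Complex.I))⁻¹‖ ^ 2 =
      1 / ((l a - E) ^ 2 + t ^ 2) := by
    intro a t
    rw [norm_inv, inv_pow, ← Complex.normSq_eq_norm_sq, Complex.normSq_apply]
    simp
    ring
  have hS : ∀ t : ℝ, 0 < t → ∑ a, w a * ‖((l a : ℂ) - ((E : ℂ) + t * Complex.I))⁻¹‖ ^ 2 = (f t).im / t := by
    intro t ht
    rw [him, Finset.sum_div]
    refine Finset.sum_congr rfl fun a _ => ?_
    rw [hq]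
    field_simp
  refine ⟨?_, ?_, ?_, ?_⟩
  · have hd : f η - f (2 * η) = (-(η * Complex.I)) * ∑ a, (w a : ℂ) *
        (((l a : ℂ) - ((E : ℂ) + η * Complex.I))⁻¹ * ((l a : ℂ) - ((E : ℂ) + ((2 * η : ℝ) : ℂ) * Complex.I))⁻¹) := by
      rw [hf, hf, ← Finset.sum_sub_distrib, Finset.mul_sum]
      refine Finset.sum_congr rfl fun a _ => ?_
      have h1 : (l a : ℂ) - ((E : ℂ) + η * Complex.I) ≠ 0 := ofReal_sub_ne _ (by simpa using hη)
      have h2 : (l a : ℂ) - ((E : ℂ) + ((2 * η : ℝ) : ℂ) * Complex.I) ≠ 0 :=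
        ofReal_sub_ne _ (by simpa using hη)
      have h3 : (l a : ℂ) - ((E : ℂ) + ((2 * η : ℝ) : ℂ) * Complex.I) =
        ((l a : ℂ) - ((E : ℂ) + η * Complex.I)) - η * Complex.I := by push_cast; ring
      rw [h3] at h2 ⊢
      generalize (l a : ℂ) - ((E : ℂ) + η * Complex.I) = x at h1 h2 ⊢
      field_simp
      ring
    have hn : ‖f η - f (2 * η)‖ ≤ η * ∑ a, (√(w a) * ‖((l a : ℂ) - ((E : ℂ) + η * Complex.I))⁻¹‖) *
        (√(w a) * ‖((l a : ℂ) - ((E : ℂ) + ((2 * η : ℝ) : ℂ) * Complex.I))⁻¹‖) := by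
      rw [hd, norm_mul]
      have : ‖-((η : ℂ) * Complex.I)‖ = η := by
        simp [abs_of_pos hη]
      rw [this]
      refine mul_le_mul_of_nonneg_left ?_ hη.le
      refine (norm_sum_le _ _).trans (Finset.sum_le_sum fun a _ => ?_)
      rw [norm_mul, norm_mul, Complex.norm_real, Real.norm_of_nonneg (hw a)]
      refine le_of_eq ?_
      rw [mul_mul_mul_comm, Real.mul_self_sqrt (hw a)]
    have hcs := Finset.sum_mul_sq_le_sq_mul_sq Finset.univ
      (fun a => √(w a) * ‖((l a : ℂ) - ((E : ℂ) + η * Complex.I))⁻¹‖)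
      (fun a => √(w a) * ‖((l a : ℂ) - ((E : ℂ) + ((2 * η : ℝ) : ℂ) * Complex.I))⁻¹‖)
    simp only [mul_pow, Real.sq_sqrt (hw _)] at hcs
    rw [hS η hη, hS (2 * η) (by linarith)] at hcs
    set S := ∑ a, (√(w a) * ‖((l a : ℂ) - ((E : ℂ) + η * Complex.I))⁻¹‖) *
        (√(w a) * ‖((l a : ℂ) - ((E : ℂ) + ((2 * η : ℝ) : ℂ) * Complex.I))⁻¹‖)
    have hS0 : 0 ≤ S := Finset.sum_nonneg fun a _ => by positivity
    have hx := (le_abs_self _).trans (Complex.abs_im_le_norm (f η))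
    have hy := (le_abs_self _).trans (Complex.abs_im_le_norm (f (2 * η)))
    have hy0 : 0 ≤ (f (2 * η)).im := by
      rw [him]; exact Finset.sum_nonneg fun a _ => mul_nonneg (hw a) (by positivity)
    have h3 : (η * S) ^ 2 ≤ ‖f η‖ * ‖f (2 * η)‖ / 2 := by
      calc (η * S) ^ 2 = η ^ 2 * S ^ 2 := by ring
        _ ≤ η ^ 2 * ((f η).im / η * ((f (2 * η)).im / (2 * η))) := by gcongr
        _ = (f η).im * (f (2 * η)).im / 2 := by field_simp
        _ ≤ _ := by gcongr
    have h4 : ‖f η‖ - ‖f (2 * η)‖ ≤ η * S := (norm_sub_norm_le _ _).trans hn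
    by_contra hc
    push Not at hc
    have hy1 := norm_nonneg (f (2 * η))
    have : (‖f η‖ - ‖f (2 * η)‖) ^ 2 ≤ (η * S) ^ 2 := by
      gcongr
      linarith
    nlinarith
  · rw [him, him, Finset.mul_sum]
    refine Finset.sum_le_sum fun a _ => ?_
    have : η / ((l a - E) ^ 2 + η ^ 2) ≤ 2 * (2 * η / ((l a - E) ^ 2 + (2 * η) ^ 2)) := by
      rw [← mul_div_assoc, div_le_div_iff₀ (by positivity) (by positivity)]
      nlinarith [mul_nonneg hη.le (sq_nonneg (l a - E))]
    nlinarith [hw a]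
  · rw [him, him, Finset.mul_sum]
    refine Finset.sum_le_sum fun a _ => ?_
    have : (2 * η / ((l a - E) ^ 2 + (2 * η) ^ 2)) ≤ 2 * (η / ((l a - E) ^ 2 + η ^ 2)) := by
      rw [← mul_div_assoc, div_le_div_iff₀ (by positivity) (by positivity)]
      nlinarith [mul_nonneg hη.le (sq_nonneg (l a - E)), pow_pos hη 3]
    nlinarith [hw a]
  · rw [him]; exact Finset.sum_nonneg fun a _ => mul_nonneg (hw a) (by positivity)

lemma rsv_scale {A : Matrix n n ℂ} (hA : A.IsHermitian) (E η : ℝ) (hη : 0 < η) (i : n) :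
    ‖rsv A (E + η * Complex.I) i i‖ ≤ 2 * ‖rsv A (E + (2 * η : ℝ) * Complex.I) i i‖ := by
  obtain ⟨l, w, hw, _, h⟩ := spectral_rep hA
  have := (rep_scale (w i) l (hw i) E η hη
    (fun t => ∑ a, (w i a : ℂ) * ((l a : ℂ) - ((E : ℂ) + t * Complex.I))⁻¹) (fun t => rfl)).1
  rw [(h _ (by simpa using hη)).2.2, (h _ (by simpa using hη)).2.2]
  exact this

lemma trace_scale {A : Matrix n n ℂ} (hA : A.IsHermitian) (E η : ℝ) (hη : 0 < η) :
    (rsv A (E + η * Complex.I)).trace.im ≤ 2 * (rsv A (E + (2 * η : ℝ) * Complex.I)).trace.im ∧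
    (rsv A (E + (2 * η : ℝ) * Complex.I)).trace.im ≤ 2 * (rsv A (E + η * Complex.I)).trace.im := by
  obtain ⟨l, w, hw, hs, h⟩ := spectral_rep hA
  have ht : ∀ t : ℝ, 0 < t → (rsv A (E + t * Complex.I)).trace =
      ∑ a, ((1 : ℝ) : ℂ) * ((l a : ℂ) - ((E : ℂ) + t * Complex.I))⁻¹ := by
    intro t ht
    rw [Matrix.trace]
    simp only [Matrix.diag_apply, (h (E + t * Complex.I) (by simpa using ht)).2.2]
    rw [Finset.sum_comm]
    refine Finset.sum_congr rfl fun a _ => ?_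
    rw [← Finset.sum_mul, ← hs a]
    push_cast
    rfl
  have := (rep_scale (fun _ => (1 : ℝ)) l (fun _ => zero_le_one) E η hη
    (fun t => ∑ a, ((1 : ℝ) : ℂ) * ((l a : ℂ) - ((E : ℂ) + t * Complex.I))⁻¹) (fun t => rfl)).2
  rw [ht η hη, ht (2 * η) (by linarith)]
  exact ⟨this.1, this.2.1⟩

lemma trace_im_nonneg {A : Matrix n n ℂ} (hA : A.IsHermitian) {z : ℂ} (hz : 0 < z.im) :
    0 ≤ (rsv A z).trace.im := by
  rw [Matrix.trace, Complex.im_sum]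
  refine Finset.sum_nonneg fun i _ => ?_
  rw [Matrix.diag_apply, ward hA hz]
  positivity

/-- matrix with row and column `k` removed (zeroed) -/
def zrow (k : n) (A : Matrix n n ℂ) : Matrix n n ℂ := fun i j => if i = k ∨ j = k then 0 else A i j

/-- column `k` without the diagonal entry -/
def zcol (k : n) (A : Matrix n n ℂ) : n → ℂ := fun i => if i = k then 0 else A i k

/-- resolvent of the minor, extended by zero -/
def mrsv (k : n) (A : Matrix n n ℂ) (z : ℂ) : Matrix n n ℂ :=
  fun i j => if i = k ∨ j = k then 0 else rsv (zrow k A) z i j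

omit [Fintype n] in
lemma zrow_herm {A : Matrix n n ℂ} (hA : A.IsHermitian) (k : n) : (zrow k A).IsHermitian := by
  ext i j
  simp only [Matrix.conjTranspose_apply, zrow]
  by_cases h1 : i = k <;> by_cases h2 : j = k <;> simp [h1, h2]
  exact hA.apply i j

lemma zrow_res {A : Matrix n n ℂ} (hA : A.IsHermitian) (k : n) {z : ℂ} (hz : 0 < z.im) :
    (∀ j, rsv (zrow k A) z k j = if j = k then -(1 / z) else 0) ∧
    (∀ i, rsv (zrow k A) z i k = if i = k then -(1 / z) else 0) := by
  have hz0 : z ≠ 0 := by rintro rfl; simp at hz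
  obtain ⟨h1, h2⟩ := rsv_mul (zrow_herm hA k) hz
  constructor
  · intro j
    have := congrFun (congrFun h1 k) j
    rw [Matrix.mul_apply, Finset.sum_eq_single k] at this
    · simp [zrow, Matrix.one_apply] at this
      by_cases hj : j = k
      · subst hj; simp at this ⊢; field_simp; linear_combination -this
      · simp [hj, Ne.symm hj, hz0] at this ⊢
        exact this
    · intro b _ hb; simp [zrow, hb.symm]
    · simp
  · intro j
    have := congrFun (congrFun h2 j) k
    rw [Matrix.mul_apply, Finset.sum_eq_single k] at this
    · simp [zrow, Matrix.one_apply] at this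
      by_cases hj : j = k
      · subst hj; simp at this ⊢; field_simp; linear_combination -this
      · simp [hj, hz0] at this ⊢
        exact this
    · intro b _ hb; simp [zrow, hb]
    · simp

lemma mrsv_sq_le {A : Matrix n n ℂ} (hA : A.IsHermitian) (k : n) {z : ℂ} (hz : 0 < z.im) :
    z.im * ∑ i, ∑ j, ‖mrsv k A z i j‖ ^ 2 = (mrsv k A z).trace.im := by
  rw [Matrix.trace, Complex.im_sum, Finset.mul_sum]
  refine Finset.sum_congr rfl fun i _ => ?_
  rw [Matrix.diag_apply]
  by_cases hi : i = k
  · simp [mrsv, hi]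
  · have : mrsv k A z i i = rsv (zrow k A) z i i := by simp [mrsv, hi]
    rw [this, ward (zrow_herm hA k) hz]
    congr 1
    refine Finset.sum_congr rfl fun j _ => ?_
    by_cases hj : j = k
    · simp [mrsv, hj, (zrow_res hA k hz).2, hi]
    · simp [mrsv, hi, hj]

lemma schur {A : Matrix n n ℂ} (hA : A.IsHermitian) (k : n) {z : ℂ} (hz : 0 < z.im) :
    (rsv A z k k)⁻¹ = A k k - z - star (zcol k A) ⬝ᵥ (mrsv k A z *ᵥ zcol k A) ∧
    ‖(rsv A z).trace - (mrsv k A z).trace‖ ≤ 1 / z.im := by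
  obtain ⟨hr1, hr2⟩ := zrow_res hA k hz
  have hZ := zrow_herm hA k
  obtain ⟨hm1, hm2⟩ := rsv_mul hZ hz
  set S := mrsv k A z with hS
  set a := zcol k A with ha
  set R := rsv (zrow k A) z with hR
  have hak : a k = 0 := by simp [ha, zcol]
  have hSk : ∀ j, S k j = 0 := fun j => by simp [hS, mrsv]
  have hSk' : ∀ j, S j k = 0 := fun j => by simp [hS, mrsv]
  have hSR : ∀ i j, i ≠ k → j ≠ k → S i j = R i j := fun i j hi hj => by simp [hS, mrsv, hi, hj, hR]
  have hSa : S *ᵥ a = R *ᵥ a := by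
    funext i
    simp only [Matrix.mulVec, dotProduct]
    refine Finset.sum_congr rfl fun j _ => ?_
    by_cases hj : j = k
    · simp [hj, hak]
    · by_cases hi : i = k
      · rw [hi, hSk, hr1]; simp [hj]
      · rw [hSR i j hi hj]
  have haS : star a ᵥ* S = star a ᵥ* R := by
    funext i
    simp only [Matrix.vecMul, dotProduct]
    refine Finset.sum_congr rfl fun j _ => ?_
    by_cases hj : j = k
    · simp [hj, hak]
    · by_cases hi : i = k
      · rw [hi, hSk', hr2]; simp [hj]
      · rw [hSR j i hj hi]
  have hSak : (S *ᵥ a) k = 0 := by simp [Matrix.mulVec, dotProduct, hSk]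
  have haSk : (star a ᵥ* S) k = 0 := by simp [Matrix.vecMul, dotProduct, hSk']
  -- norm computations
  have hn1 : star a ⬝ᵥ ((Rᴴ * R) *ᵥ a) = ((∑ i, ‖(R *ᵥ a) i‖ ^ 2 : ℝ) : ℂ) := by
    rw [← Matrix.mulVec_mulVec, Matrix.dotProduct_mulVec, ← Matrix.star_mulVec, dotProduct]
    push_cast
    refine Finset.sum_congr rfl fun i _ => ?_
    rw [← Complex.conj_mul']; rfl
  have hn2 : star a ⬝ᵥ ((R * Rᴴ) *ᵥ a) = ((∑ i, ‖(star a ᵥ* R) i‖ ^ 2 : ℝ) : ℂ) := by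
    rw [← Matrix.mulVec_mulVec, Matrix.dotProduct_mulVec, dotProduct]
    push_cast
    refine Finset.sum_congr rfl fun i _ => ?_
    rw [← Complex.mul_conj']
    congr 1
    have : Rᴴ *ᵥ a = star (star a ᵥ* R) := by rw [Matrix.star_vecMul, star_star]
    rw [this]; rfl
  have hn3 : (∑ i, ‖(star a ᵥ* R) i‖ ^ 2 : ℝ) = ∑ i, ‖(R *ᵥ a) i‖ ^ 2 := by
    have : (((∑ i, ‖(star a ᵥ* R) i‖ ^ 2 : ℝ)) : ℂ) = ((∑ i, ‖(R *ᵥ a) i‖ ^ 2 : ℝ) : ℂ) := by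
      rw [← hn1, ← hn2, rsv_normal hZ hz]
    exact_mod_cast this
  set q := star a ⬝ᵥ (S *ᵥ a) with hq
  have hqim : q.im = z.im * ∑ i, ‖(R *ᵥ a) i‖ ^ 2 := by
    have h1 : star a ⬝ᵥ ((R - Rᴴ) *ᵥ a) = (z - conj z) * ((∑ i, ‖(R *ᵥ a) i‖ ^ 2 : ℝ) : ℂ) := by
      rw [(rsv_sub_conj hZ hz).2, ← hn1, Matrix.smul_mulVec, dotProduct_smul, smul_eq_mul]
    have h2 : star a ⬝ᵥ ((R - Rᴴ) *ᵥ a) = q - conj q := by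
      rw [Matrix.sub_mulVec, dotProduct_sub, hq, hSa]
      congr 1
      have : conj (star a ⬝ᵥ R *ᵥ a) = star (star a ⬝ᵥ R *ᵥ a) := rfl
      rw [this, Matrix.star_dotProduct, Matrix.star_mulVec, Matrix.conjTranspose_conjTranspose,
        ← Matrix.dotProduct_mulVec]
    rw [h2] at h1
    generalize (∑ i, ‖(R *ᵥ a) i‖ ^ 2 : ℝ) = T at h1 ⊢
    have := congrArg Complex.im h1
    simp at this
    linarith
  set T := ∑ i, ‖(R *ᵥ a) i‖ ^ 2 with hT
  have hT0 : 0 ≤ T := Finset.sum_nonneg fun i _ => by positivity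
  have hAkk : (A k k).im = 0 := by
    have := hA.apply k k
    exact Complex.conj_eq_iff_im.mp this
  set c := A k k - z - q with hc
  have hcim : c.im = - (z.im * (1 + T)) := by
    rw [hc, Complex.sub_im, Complex.sub_im, hAkk, hqim]; ring
  have hcn : z.im * (1 + T) ≤ ‖c‖ := by
    have := Complex.abs_im_le_norm c
    rw [hcim, abs_neg] at this
    exact (le_abs_self _).trans this
  have hcpos : 0 < ‖c‖ := lt_of_lt_of_le (by positivity) hcn
  have hc0 : c ≠ 0 := norm_pos_iff.mp hcpos
  set e : n → ℂ := Pi.single k 1 with he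
  set v := e - S *ᵥ a with hv
  set v' := e - star a ᵥ* S with hv'
  have f1 : (A - z • (1 : Matrix n n ℂ)) * S = 1 - Matrix.vecMulVec e v' := by
    ext i j
    by_cases hi : i = k
    · subst hi
      simp only [Matrix.sub_apply, Matrix.vecMulVec_apply, hv', he, Pi.sub_apply, Pi.single_eq_same,
        one_mul, Matrix.sub_mul, Matrix.smul_mul, Matrix.smul_apply, hSk, smul_zero, sub_zero]
      have : (1 : Matrix n n ℂ) i j = (Pi.single i 1 : n → ℂ) j := by
        rw [Matrix.one_apply, Pi.single_apply]; simp [eq_comm]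
      rw [this, sub_sub_cancel, Matrix.mul_apply, Matrix.vecMul, dotProduct]
      refine Finset.sum_congr rfl fun l _ => ?_
      by_cases hl : l = i
      · rw [hl, hSk]; simp
      · congr 1
        simp [ha, zcol, hl]
        exact (hA.apply i l).symm
    · by_cases hj : j = k
      · simp only [hj, Matrix.mul_apply, hSk', mul_zero, Finset.sum_const_zero, Matrix.sub_apply,
          Matrix.vecMulVec_apply, he]
        simp [hi]
      · have h1 := congrFun (congrFun hm1 i) j
        simp only [Matrix.sub_apply, Matrix.vecMulVec_apply, he]
        rw [Pi.single_eq_of_ne hi, zero_mul, sub_zero, ← h1, Matrix.mul_apply, Matrix.mul_apply]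
        refine Finset.sum_congr rfl fun l _ => ?_
        by_cases hl : l = k
        · rw [hl, hSk, hr1]; simp [hj]
        · rw [hSR l j hl hj]
          simp [zrow, hi, hl]
  have f2 : (A - z • (1 : Matrix n n ℂ)) *ᵥ v = c • e := by
    rw [hv, Matrix.mulVec_sub, Matrix.mulVec_mulVec, f1, Matrix.sub_mulVec 1, Matrix.one_mulVec]
    have h1 : (Matrix.vecMulVec e v') *ᵥ a = (- q) • e := by
      rw [Matrix.vecMulVec_mulVec]
      have : v' ⬝ᵥ a = - q := by
        rw [hv', sub_dotProduct, he, single_dotProduct, hak, hq, Matrix.dotProduct_mulVec]; ring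
      rw [this]
      ext i; simp [mul_comm]
    rw [h1]
    ext i
    by_cases hi : i = k
    · subst hi
      simp [he, hak, hc]
    · simp [he, hi, ha, zcol]
  have f3 : (A - z • (1 : Matrix n n ℂ)) * (S + c⁻¹ • Matrix.vecMulVec v v') = 1 := by
    rw [Matrix.mul_add, Matrix.mul_smul, f1, Matrix.mul_vecMulVec, f2, Matrix.smul_vecMulVec, smul_smul,
      inv_mul_cancel₀ hc0, one_smul, sub_add_cancel]
  have f4 : rsv A z = S + c⁻¹ • Matrix.vecMulVec v v' := Matrix.inv_eq_right_inv f3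
  constructor
  · rw [f4]
    simp [hSk, Matrix.vecMulVec_apply, hv, hv', he, hSak, haSk]
  · rw [f4, Matrix.trace_add, Matrix.trace_smul, Matrix.trace_vecMulVec, add_sub_cancel_left, smul_eq_mul,
      norm_mul, norm_inv]
    have h1 : v ⬝ᵥ v' = 1 + (star a ᵥ* R) ⬝ᵥ (R *ᵥ a) := by
      rw [← haS, ← hSa, hv, hv', sub_dotProduct, dotProduct_sub, dotProduct_sub, he, single_dotProduct,
        single_dotProduct, dotProduct_single, hSak, haSk, dotProduct_comm (S *ᵥ a)]
      simp
    have h2 : ‖(star a ᵥ* R) ⬝ᵥ (R *ᵥ a)‖ ≤ T := by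
      rw [dotProduct]
      refine (norm_sum_le _ _).trans ?_
      have : T = ∑ i, (‖(star a ᵥ* R) i‖ ^ 2 + ‖(R *ᵥ a) i‖ ^ 2) / 2 := by
        rw [← Finset.sum_div, Finset.sum_add_distrib, hn3]; ring
      rw [this]
      refine Finset.sum_le_sum fun i _ => ?_
      rw [norm_mul]
      nlinarith [sq_nonneg (‖(star a ᵥ* R) i‖ - ‖(R *ᵥ a) i‖)]
    have h3 : ‖v ⬝ᵥ v'‖ ≤ 1 + T := by
      rw [h1]
      refine (norm_add_le _ _).trans ?_
      simpa using h2
    rw [inv_mul_eq_div, div_le_div_iff₀ hcpos hz]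
    nlinarith
end Resolvent


lemma sin_series {w : ℂ} (hw : ‖w‖ < 1) (θ : ℝ) :
    HasSum (fun n : ℕ => w ^ n * (Real.sin ((n + 1 : ℝ) * θ) : ℂ))
      ((Real.sin θ : ℂ) / (1 - 2 * w * Real.cos θ + w ^ 2)) := by
  set e : ℂ := Complex.exp (θ * Complex.I) with he
  set e' : ℂ := Complex.exp (-(θ * Complex.I)) with he'
  have hee : e * e' = 1 := by rw [he, he', ← Complex.exp_add]; simp
  have hne : ‖e‖ = 1 := Complex.norm_exp_ofReal_mul_I θ
  have hne' : ‖e'‖ = 1 := by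
    have := Complex.norm_exp_ofReal_mul_I (-θ)
    rwa [Complex.ofReal_neg, neg_mul] at this
  have h1 : ‖w * e‖ < 1 := by rw [norm_mul, hne, mul_one]; exact hw
  have h2 : ‖w * e'‖ < 1 := by rw [norm_mul, hne', mul_one]; exact hw
  have n1 : 1 - w * e ≠ 0 := by
    intro h
    have : w * e = 1 := by linear_combination -h
    rw [this] at h1; simp at h1
  have n2 : 1 - w * e' ≠ 0 := by
    intro h
    have : w * e' = 1 := by linear_combination -h
    rw [this] at h2; simp at h2
  have s1 := ((hasSum_geometric_of_norm_lt_one h1).mul_left e)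
  have s2 := ((hasSum_geometric_of_norm_lt_one h2).mul_left e')
  have s3 := (s1.sub s2).mul_left (1 / (2 * Complex.I))
  have hsin : (Real.sin θ : ℂ) = (e - e') / (2 * Complex.I) := by
    rw [Complex.ofReal_sin, Complex.sin, he, he', neg_mul]
    field_simp
    rw [Complex.I_sq]
    ring
  have hcos : (Real.cos θ : ℂ) = (e + e') / 2 := by
    rw [Complex.ofReal_cos, Complex.cos, he, he', neg_mul]
  have hf : (fun n : ℕ => w ^ n * (Real.sin ((n + 1 : ℝ) * θ) : ℂ)) =
      fun i => 1 / (2 * Complex.I) * (e * (w * e) ^ i - e' * (w * e') ^ i) := by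
    funext n
    have a1 : e ^ (n + 1) = Complex.exp (((n + 1 : ℝ) * θ : ℝ) * Complex.I) := by
      rw [he, ← Complex.exp_nat_mul]; push_cast; ring_nf
    have a2 : e' ^ (n + 1) = Complex.exp (-((((n + 1 : ℝ) * θ : ℝ) : ℂ) * Complex.I)) := by
      rw [he', ← Complex.exp_nat_mul]; push_cast; ring_nf
    have a3 : (Real.sin ((n + 1 : ℝ) * θ) : ℂ) = (e ^ (n + 1) - e' ^ (n + 1)) / (2 * Complex.I) := by
      rw [a1, a2, Complex.ofReal_sin, Complex.sin, neg_mul]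
      field_simp
      rw [Complex.I_sq]
      ring
    rw [a3, mul_pow, mul_pow, pow_succ, pow_succ]
    field_simp
  have hv : ((Real.sin θ : ℂ) / (1 - 2 * w * Real.cos θ + w ^ 2)) =
      (1 / (2 * Complex.I) * (e * (1 - w * e)⁻¹ - e' * (1 - w * e')⁻¹)) := by
    have hd : (1 - 2 * w * Real.cos θ + w ^ 2 : ℂ) = (1 - w * e) * (1 - w * e') := by
      rw [hcos]; linear_combination (-w ^ 2) * hee
    have key : e * (1 - w * e)⁻¹ - e' * (1 - w * e')⁻¹ = (e - e') * ((1 - w * e) * (1 - w * e'))⁻¹ := by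
      rw [mul_inv]
      linear_combination (-(e * (1 - w * e)⁻¹)) * (mul_inv_cancel₀ n2) +
        (e' * (1 - w * e')⁻¹) * (mul_inv_cancel₀ n1)
    rw [hsin, hd, key]
    ring
  rw [hf, hv]
  exact s3

lemma int_cos (k : ℕ) (hk : k ≠ 0) : ∫ θ in (0 : ℝ)..Real.pi, Real.cos (k * θ) = 0 := by
  have : (k : ℝ) ≠ 0 := by exact_mod_cast hk
  rw [intervalIntegral.integral_comp_mul_left (fun x => Real.cos x) this]
  simp [Real.sin_nat_mul_pi]

lemma int_sin_sin (n : ℕ) : ∫ θ in (0 : ℝ)..Real.pi, Real.sin θ * Real.sin ((n + 1 : ℝ) * θ) =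
    if n = 0 then Real.pi / 2 else 0 := by
  have h : ∀ θ : ℝ, Real.sin θ * Real.sin ((n + 1 : ℝ) * θ) =
      (Real.cos ((n : ℕ) * θ) - Real.cos ((n + 2 : ℕ) * θ)) / 2 := by
    intro θ
    have e1 : ((n + 2 : ℕ) : ℝ) * θ = (n + 1 : ℝ) * θ + θ := by push_cast; ring
    have e2 : ((n : ℕ) : ℝ) * θ = (n + 1 : ℝ) * θ - θ := by push_cast; ring
    rw [e1, e2, Real.cos_add, Real.cos_sub]; ring
  simp_rw [h]
  rw [intervalIntegral.integral_div, intervalIntegral.integral_sub, int_cos (n + 2) (by omega)]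
  · split_ifs with h0
    · subst h0; simp
    · rw [int_cos n h0]; simp
  · exact (by fun_prop : Continuous fun θ : ℝ => Real.cos ((n : ℕ) * θ)).intervalIntegrable _ _
  · exact (by fun_prop : Continuous fun θ : ℝ => Real.cos ((n + 2 : ℕ) * θ)).intervalIntegrable _ _

lemma int_semi {w : ℂ} (hw : ‖w‖ < 1) :
    ∫ θ in (0 : ℝ)..Real.pi, (Real.sin θ : ℂ) * ((Real.sin θ : ℂ) / (1 - 2 * w * Real.cos θ + w ^ 2)) =
      (Real.pi / 2 : ℂ) := by
  have h := intervalIntegral.hasSum_integral_of_dominated_convergence (μ := volume) (a := 0) (b := Real.pi)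
    (F := fun (n : ℕ) (θ : ℝ) => (Real.sin θ : ℂ) * (w ^ n * (Real.sin ((n + 1 : ℝ) * θ) : ℂ)))
    (f := fun θ : ℝ => (Real.sin θ : ℂ) * ((Real.sin θ : ℂ) / (1 - 2 * w * Real.cos θ + w ^ 2)))
    (fun n _ => ‖w‖ ^ n) (fun n => by
      apply Continuous.aestronglyMeasurable; fun_prop) (fun n => Filter.Eventually.of_forall fun θ _ => by
      rw [norm_mul, norm_mul, norm_pow, Complex.norm_real, Complex.norm_real]
      have h1 := Real.abs_sin_le_one θ
      have h2 := Real.abs_sin_le_one ((n + 1 : ℝ) * θ)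
      have h3 : 0 ≤ ‖w‖ ^ n := by positivity
      rw [Real.norm_eq_abs, Real.norm_eq_abs]
      calc _ ≤ 1 * (‖w‖ ^ n * 1) := by gcongr
        _ = _ := by ring)
    (Filter.Eventually.of_forall fun θ _ => summable_geometric_of_lt_one (norm_nonneg _) hw)
    (by simp) (Filter.Eventually.of_forall fun θ _ => (sin_series hw θ).mul_left _)
  have h2 : HasSum (fun n : ℕ => ∫ θ in (0 : ℝ)..Real.pi, (Real.sin θ : ℂ) * (w ^ n * (Real.sin ((n + 1 : ℝ) * θ) : ℂ)))
      (Real.pi / 2 : ℂ) := by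
    have : ∀ n : ℕ, ∫ θ in (0 : ℝ)..Real.pi, (Real.sin θ : ℂ) * (w ^ n * (Real.sin ((n + 1 : ℝ) * θ) : ℂ)) =
        if n = 0 then (Real.pi / 2 : ℂ) else 0 := by
      intro n
      have e : ∀ θ : ℝ, (Real.sin θ : ℂ) * (w ^ n * (Real.sin ((n + 1 : ℝ) * θ) : ℂ)) =
          w ^ n * ((Real.sin θ * Real.sin ((n + 1 : ℝ) * θ) : ℝ) : ℂ) := by
        intro θ; push_cast; ring
      simp_rw [e]
      rw [intervalIntegral.integral_const_mul, intervalIntegral.integral_ofReal, int_sin_sin]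
      split_ifs with h0
      · subst h0; simp
      · simp
    simp_rw [this]
    exact hasSum_ite_eq 0 _
  exact h.unique h2

lemma msc_eq {z w : ℂ} (hz : 0 < z.im) (hw : ‖w‖ < 1) (he : w ^ 2 + z * w + 1 = 0) : mSC z = w := by
  have hw0 : w ≠ 0 := by rintro rfl; simp at he
  set g : ℝ → ℂ := fun u => ((Real.sqrt (4 - u ^ 2) / (2 * Real.pi) : ℝ) : ℂ) / ((u : ℂ) - z) with hg
  have hgc : Continuous g := by
    rw [hg]
    refine Continuous.div ?_ (by fun_prop) (fun u => ofReal_sub_ne u hz)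
    exact Complex.continuous_ofReal.comp (by fun_prop)
  have h1 : mSC z = ∫ u in (-2 : ℝ)..2, g u := by
    rw [intervalIntegral.integral_of_le (by norm_num), mSC,
      ← setIntegral_eq_integral_of_forall_compl_eq_zero (s := Set.Ioc (-2 : ℝ) 2)]
    · refine setIntegral_congr_fun measurableSet_Ioc fun u hu => ?_
      have : |u| ≤ 2 := abs_le.mpr ⟨hu.1.le, hu.2⟩
      simp [rhoSC, this, hg]
    · intro u hu
      have : rhoSC u = 0 := by
        rw [rhoSC]
        split_ifs with h
        · rw [abs_le] at h
          rw [Set.mem_Ioc, not_and_or] at hu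
          have : u = -2 := by
            rcases hu with hu | hu
            · linarith
            · exact absurd h.2 hu
          rw [this]; norm_num
        · rfl
      rw [this]; simp
  have h2 := intervalIntegral.integral_deriv_smul_comp (a := 0) (b := Real.pi) (f := fun θ => -2 * Real.cos θ)
    (f' := fun θ => 2 * Real.sin θ) (g := g) (fun θ _ => by
      have := (Real.hasDerivAt_cos θ).const_mul (-2)
      exact this.congr_deriv (by ring)) (by fun_prop) hgc
  have e1 : -2 * Real.cos 0 = -2 := by simp
  have e2 : -2 * Real.cos Real.pi = 2 := by simp
  rw [e1, e2] at h2
  rw [h1, ← h2]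
  have h3 : ∀ θ ∈ Set.uIcc 0 Real.pi, (2 * Real.sin θ) • (g ∘ fun θ => -2 * Real.cos θ) θ =
      (2 * w / Real.pi) * ((Real.sin θ : ℂ) * ((Real.sin θ : ℂ) / (1 - 2 * w * Real.cos θ + w ^ 2))) := by
    intro θ hθ
    rw [Set.uIcc_of_le Real.pi_pos.le] at hθ
    have hs : 0 ≤ Real.sin θ := Real.sin_nonneg_of_mem_Icc hθ
    have hsq : Real.sqrt (4 - (-2 * Real.cos θ) ^ 2) = 2 * Real.sin θ := by
      rw [← Real.sqrt_sq (by positivity : 0 ≤ 2 * Real.sin θ)]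
      congr 1
      nlinarith [Real.sin_sq_add_cos_sq θ]
    have hden : ((-2 * Real.cos θ : ℝ) : ℂ) - z = (1 - 2 * w * Real.cos θ + w ^ 2) / w := by
      field_simp
      push_cast
      linear_combination -he
    have hne := ofReal_sub_ne (-2 * Real.cos θ) hz
    have hpi : (Real.pi : ℂ) ≠ 0 := by exact_mod_cast Real.pi_ne_zero
    simp only [hg, Function.comp, hsq]
    rw [hden] at hne ⊢
    have hD : (1 - 2 * w * Real.cos θ + w ^ 2 : ℂ) ≠ 0 := by
      intro h; rw [h] at hne; simp at hne
    rw [Complex.real_smul]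
    push_cast
    generalize hDD : (1 - 2 * w * Complex.cos θ + w ^ 2 : ℂ) = DD
    have hD' : DD ≠ 0 := by rw [← hDD]; simpa using hD
    field_simp
  rw [intervalIntegral.integral_congr h3, intervalIntegral.integral_const_mul, int_semi hw]
  have hpi : (Real.pi : ℂ) ≠ 0 := by exact_mod_cast Real.pi_ne_zero
  field_simp

lemma exists_root {z : ℂ} (hz : 0 < z.im) : ∃ w : ℂ, ‖w‖ < 1 ∧ w ^ 2 + z * w + 1 = 0 := by
  obtain ⟨s, hs⟩ := IsAlgClosed.exists_pow_nat_eq (z ^ 2 - 4) (n := 2) (by norm_num)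
  have key : ∀ w : ℂ, w ^ 2 + z * w + 1 = 0 → ‖w‖ ≠ 1 := by
    intro w hw h1
    have h2 : w * conj w = 1 := by rw [Complex.mul_conj', h1]; simp
    have h3 : z = -(w + conj w) := by
      have hw0 : w ≠ 0 := by rintro rfl; simp at h1
      apply mul_left_cancel₀ hw0
      linear_combination hw + h2
    rw [h3] at hz
    simp at hz
  set w1 := (-z + s) / 2 with hw1
  set w2 := (-z - s) / 2 with hw2
  have r1 : w1 ^ 2 + z * w1 + 1 = 0 := by rw [hw1]; linear_combination hs / 4
  have r2 : w2 ^ 2 + z * w2 + 1 = 0 := by rw [hw2]; linear_combination hs / 4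
  have hp : w1 * w2 = 1 := by rw [hw1, hw2]; linear_combination -hs / 4
  have hpn : ‖w1‖ * ‖w2‖ = 1 := by rw [← norm_mul, hp]; simp
  by_cases h : ‖w1‖ < 1
  · exact ⟨w1, h, r1⟩
  · refine ⟨w2, ?_, r2⟩
    have h1 : 1 < ‖w1‖ := lt_of_le_of_ne (not_lt.mp h) (key w1 r1).symm
    by_contra h2
    nlinarith

lemma msc_props {z : ℂ} (hz : 0 < z.im) :
    mSC z ^ 2 + z * mSC z + 1 = 0 ∧ ‖mSC z‖ < 1 ∧ 0 < (mSC z).im := by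
  obtain ⟨w, h1, h2⟩ := exists_root hz
  rw [msc_eq hz h1 h2]
  refine ⟨h2, h1, ?_⟩
  have hre := congrArg Complex.re h2
  have him := congrArg Complex.im h2
  simp [pow_two] at hre him
  have hn : w.re * w.re + w.im * w.im < 1 := by
    rw [← Complex.normSq_apply, Complex.normSq_eq_norm_sq]
    nlinarith [norm_nonneg w]
  have hw0 : w ≠ 0 := by rintro rfl; simp at h2
  have hpos : 0 < w.re * w.re + w.im * w.im := by
    rw [← Complex.normSq_apply]; exact Complex.normSq_pos.mpr hw0
  have e : w.im * (1 - (w.re * w.re + w.im * w.im)) = z.im * (w.re * w.re + w.im * w.im) := by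
    linear_combination hre * w.im - him * w.re
  have : 0 < w.im * (1 - (w.re * w.re + w.im * w.im)) := by rw [e]; positivity
  exact pos_of_mul_pos_left this (by linarith)

lemma msc_lower {κ E η : ℝ} (hκ : 0 < κ) (hE : E ∈ Set.Icc (-2 + κ) (2 - κ)) (h0 : 0 < η) (h2 : η ≤ 2) :
    √(κ / 50) ≤ (mSC (E + η * Complex.I)).im := by
  obtain ⟨h1, hn, hp⟩ := msc_props (z := E + η * Complex.I) (by simpa using h0)
  set w := mSC (E + η * Complex.I) with hw
  have hE1 := hE.1
  have hE2 := hE.2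
  have habs : |E| ≤ 2 := abs_le.mpr ⟨by linarith, by linarith⟩
  have hz : ‖(E + η * Complex.I : ℂ) + w‖ ≤ 5 := by
    calc _ ≤ ‖(E : ℂ)‖ + ‖(η : ℂ) * Complex.I‖ + ‖w‖ :=
          (norm_add_le _ _).trans (by gcongr; exact norm_add_le _ _)
      _ ≤ 2 + 2 + 1 := by
          have : ‖(η : ℂ) * Complex.I‖ ≤ 2 := by
            rw [norm_mul, Complex.norm_I, mul_one, Complex.norm_real, Real.norm_eq_abs, abs_of_pos h0]
            exact h2
          have h3 : ‖(E : ℂ)‖ ≤ 2 := by rw [Complex.norm_real]; exact habs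
          linarith
      _ = 5 := by norm_num
  have hprod : ‖w‖ * ‖(E + η * Complex.I : ℂ) + w‖ = 1 := by
    rw [← norm_mul]
    have : w * ((E + η * Complex.I : ℂ) + w) = -1 := by linear_combination h1
    rw [this]; simp
  have hw5 : 1 / 5 ≤ ‖w‖ := by nlinarith [norm_nonneg w]
  have hρ : w.re ^ 2 + w.im ^ 2 = ‖w‖ ^ 2 := by
    rw [← Complex.normSq_eq_norm_sq, Complex.normSq_apply]; ring
  have hre := congrArg Complex.re h1
  have him := congrArg Complex.im h1
  simp [pow_two] at hre him
  set ρ := w.re ^ 2 + w.im ^ 2 with hρd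
  have hρ1 : 1 / 25 ≤ ρ := by rw [hρ]; nlinarith
  have hx : w.re * (1 + ρ) = - E * ρ := by
    rw [hρd]; linear_combination hre * w.re + him * w.im
  have hx2 : w.re ^ 2 ≤ E ^ 2 * ρ / 4 := by
    have e1 : w.re ^ 2 * (1 + ρ) ^ 2 = E ^ 2 * ρ ^ 2 := by
      rw [← mul_pow, hx]; ring
    have e2 : 4 * ρ ≤ (1 + ρ) ^ 2 := by nlinarith [sq_nonneg (1 - ρ)]
    have e3 : w.re ^ 2 * (4 * ρ) ≤ E ^ 2 * ρ ^ 2 := by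
      rw [← e1]; gcongr
    have : 0 < ρ := by linarith
    nlinarith
  have hE4 : E ^ 2 ≤ 4 - 2 * κ := by
    rcases le_total 0 E with h | h <;> nlinarith
  have hy : κ / 50 ≤ w.im ^ 2 := by
    have : w.im ^ 2 = ρ - w.re ^ 2 := by rw [hρd]; ring
    have h5 : κ / 2 * ρ ≤ ρ * (1 - E ^ 2 / 4) := by nlinarith
    nlinarith
  rw [Real.sqrt_le_left hp.le]
  exact hy


/-- extended nonnegative exponential -/
def ee (x : ℝ) : ℝ≥0∞ := ENNReal.ofReal (Real.exp x)

lemma ee_add (x y : ℝ) : ee (x + y) = ee x * ee y := by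
  rw [ee, ee, ee, Real.exp_add, ENNReal.ofReal_mul (Real.exp_pos _).le]

lemma ee_mono {x y : ℝ} (h : x ≤ y) : ee x ≤ ee y :=
  ENNReal.ofReal_le_ofReal (Real.exp_le_exp.mpr h)

lemma ee_zero : ee 0 = 1 := by simp [ee]

lemma ee_ne_top (x : ℝ) : ee x ≠ ⊤ := ENNReal.ofReal_ne_top

lemma ee_half (x y : ℝ) : ee ((x + y) / 2) ≤ ee x + ee y := by
  rcases le_total x y with h | h
  · exact (ee_mono (by linarith : (x + y) / 2 ≤ y)).trans le_add_self
  · exact (ee_mono (by linarith : (x + y) / 2 ≤ x)).trans le_self_add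

lemma ee_amgm (x y : ℝ) : ee ((x + y) / 2) ≤ ENNReal.ofReal ((Real.exp x + Real.exp y) / 2) := by
  apply ENNReal.ofReal_le_ofReal
  have h1 : Real.exp ((x + y) / 2) = Real.exp (x / 2) * Real.exp (y / 2) := by
    rw [← Real.exp_add]; ring_nf
  have h2 : Real.exp x = Real.exp (x / 2) ^ 2 := by rw [pow_two, ← Real.exp_add]; ring_nf
  have h3 : Real.exp y = Real.exp (y / 2) ^ 2 := by rw [pow_two, ← Real.exp_add]; ring_nf
  rw [h1, h2, h3]
  nlinarith [sq_nonneg (Real.exp (x / 2) - Real.exp (y / 2))]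

lemma measurable_ee : Measurable ee := by
  unfold ee; fun_prop

@[fun_prop]
lemma Measurable.ee {α : Type*} [MeasurableSpace α] {f : α → ℝ} (hf : Measurable f) :
    Measurable fun x => ee (f x) := measurable_ee.comp hf

lemma exp_le_quad (x : ℝ) : Real.exp x ≤ 1 + x + x ^ 2 * Real.exp |x| := by
  by_cases h : |x| ≤ 1
  · have h1 := (abs_le.mp (Real.abs_exp_sub_one_sub_id_le h)).2
    have h2 : 1 ≤ Real.exp |x| := Real.one_le_exp (abs_nonneg x)
    nlinarith [sq_nonneg x]
  · push Not at h
    have h2 : 1 ≤ Real.exp |x| := Real.one_le_exp (abs_nonneg x)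
    rcases le_total 0 x with hx | hx
    · rw [abs_of_nonneg hx] at *
      nlinarith [mul_nonneg (by nlinarith : 0 ≤ x ^ 2 - 1) (Real.exp_pos x).le]
    · rw [abs_of_nonpos hx] at *
      have : Real.exp x ≤ 1 := Real.exp_le_one_iff.mpr hx
      nlinarith [sq_nonneg x]

lemma exp_le_id_add (x : ℝ) : Real.exp x ≤ x + Real.exp (x ^ 2) := by
  have h3 := Real.add_one_le_exp (x ^ 2)
  by_cases h : |x| ≤ 1
  · have h1 := (abs_le.mp (Real.abs_exp_sub_one_sub_id_le h)).2
    linarith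
  · push Not at h
    rcases le_total 0 x with hx | hx
    · rw [abs_of_nonneg hx] at *
      have : Real.exp x ≤ Real.exp (x ^ 2) := Real.exp_le_exp.mpr (by nlinarith)
      linarith
    · rw [abs_of_nonpos hx] at *
      have : Real.exp x ≤ 1 := Real.exp_le_one_iff.mpr hx
      nlinarith

/-- sub-Gaussian type single site condition -/
def SG (μ : Measure ℂ) (φ : ℂ → ℂ) (C g₀ : ℝ) : Prop :=
  ∀ (c : ℂ) (g : ℝ), |g| ≤ g₀ →
    ∫⁻ y, ee (2 * (conj c * φ y).re + g * (‖φ y‖ ^ 2 - 1)) ∂μ ≤ ee (C * (‖c‖ ^ 2 + g ^ 2))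

section single
variable {μ : Measure ℂ} [IsProbabilityMeasure μ] {δ₀ D : ℝ}

lemma site_bound {f Y h : ℂ → ℝ} {a b : ℝ} (hf : ∀ y, 0 ≤ f y) (hb : 0 ≤ b)
    (hY : Integrable Y μ) (hY0 : ∫ y, Y y ∂μ = 0) (hh : Integrable h μ) (hD : ∫ y, h y ∂μ ≤ D)
    (hle : ∀ y, f y ≤ a + Y y + b * h y) :
    ∫⁻ y, ENNReal.ofReal (f y) ∂μ ≤ ENNReal.ofReal (a + b * D) := by
  calc _ ≤ ∫⁻ y, ENNReal.ofReal (a + Y y + b * h y) ∂μ :=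
        lintegral_mono fun y => ENNReal.ofReal_le_ofReal (hle y)
    _ = ENNReal.ofReal (∫ y, (a + Y y + b * h y) ∂μ) := by
        rw [ofReal_integral_eq_lintegral_ofReal]
        · exact ((integrable_const a).add hY).add (hh.const_mul b)
        · exact Filter.Eventually.of_forall fun y => (hf y).trans (hle y)
    _ ≤ _ := by
        apply ENNReal.ofReal_le_ofReal
        have e1 : ∫ y, (a + Y y + b * h y) ∂μ = ∫ y, (a + Y y) ∂μ + ∫ y, b * h y ∂μ :=
          integral_add ((integrable_const a).add hY) (hh.const_mul b)
        have e2 : ∫ y, (a + Y y) ∂μ = ∫ y, a ∂μ + ∫ y, Y y ∂μ := integral_add (integrable_const a) hY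
        rw [e1, e2, hY0, integral_const_mul]
        simp
        gcongr

variable (hδ : 0 < δ₀) (hmean : ∫ z, z ∂μ = 0) (hvar : ∫ z, ‖z‖ ^ 2 ∂μ = 1)
  (hexp : ∫⁻ z, ENNReal.ofReal (Real.exp (δ₀ * ‖z‖ ^ 2)) ∂μ ≤ ENNReal.ofReal D)

include hexp in
lemma site_int : Integrable (fun z : ℂ => Real.exp (δ₀ * ‖z‖ ^ 2)) μ := by
  refine ⟨by fun_prop, ?_⟩
  rw [hasFiniteIntegral_iff_ofReal (Filter.Eventually.of_forall fun z => (Real.exp_pos _).le)]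
  exact hexp.trans_lt ENNReal.ofReal_lt_top

include hδ hexp in
lemma site_D : ∫ z, Real.exp (δ₀ * ‖z‖ ^ 2) ∂μ ≤ D ∧ 1 ≤ D := by
  have h1 := ofReal_integral_eq_lintegral_ofReal (site_int hexp)
    (Filter.Eventually.of_forall fun z => (Real.exp_pos _).le)
  rw [← h1] at hexp
  have h2 : 1 ≤ ∫ z, Real.exp (δ₀ * ‖z‖ ^ 2) ∂μ := by
    have : ∫ z, (1 : ℝ) ∂μ ≤ ∫ z, Real.exp (δ₀ * ‖z‖ ^ 2) ∂μ := by
      apply integral_mono_of_nonneg (Filter.Eventually.of_forall fun z => by simp)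
        (site_int (D := D) (by rwa [← h1]))
      exact Filter.Eventually.of_forall fun z => Real.one_le_exp (by positivity)
    simpa using this
  rcases le_total 0 D with hD | hD
  · have := (ENNReal.ofReal_le_ofReal_iff hD).mp hexp
    exact ⟨this, h2.trans this⟩
  · rw [ENNReal.ofReal_of_nonpos hD] at hexp
    have := ENNReal.ofReal_eq_zero.mp (le_antisymm hexp bot_le)
    linarith

include hδ hexp in
lemma site_int_id : Integrable (fun z : ℂ => z) μ ∧ Integrable (fun z : ℂ => ‖z‖ ^ 2) μ := by
  have h2 : Integrable (fun z : ℂ => ‖z‖ ^ 2) μ := by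
    refine ((site_int hexp).const_mul (1 / δ₀)).mono' (by fun_prop) (Filter.Eventually.of_forall fun z => ?_)
    rw [Real.norm_of_nonneg (by positivity)]
    have := Real.add_one_le_exp (δ₀ * ‖z‖ ^ 2)
    rw [div_mul_eq_mul_div, le_div_iff₀ hδ]
    nlinarith
  refine ⟨?_, h2⟩
  refine (h2.add (integrable_const 1)).mono' (by fun_prop) (Filter.Eventually.of_forall fun z => ?_)
  simp only [Pi.add_apply]
  nlinarith [sq_nonneg (‖z‖ - 1)]

include hδ hmean hexp in
lemma site_linear (c : ℂ) : ∫⁻ y, ee (4 * (conj c * y).re) ∂μ ≤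
    ee ((16 * D + 4) / δ₀ * ‖c‖ ^ 2) := by
  obtain ⟨hD, hD1⟩ := site_D hδ hexp
  have hre : ∀ y : ℂ, |(conj c * y).re| ≤ ‖c‖ * ‖y‖ := fun y => by
    refine (Complex.abs_re_le_norm _).trans ?_
    rw [norm_mul, RCLike.norm_conj]
  set θ := 16 * ‖c‖ ^ 2 / δ₀ with hθ
  have hθ0 : 0 ≤ θ := by positivity
  have hC : (16 * D + 4) / δ₀ * ‖c‖ ^ 2 = θ * D + 4 * ‖c‖ ^ 2 / δ₀ := by rw [hθ]; ring
  rw [hC]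
  by_cases h : θ ≤ 1
  · have hYi : Integrable (fun y : ℂ => 4 * (conj c * y).re) μ :=
      (((site_int_id hδ hexp).1.const_mul (conj c)).re).const_mul 4
    have hY0 : ∫ y, 4 * (conj c * y).re ∂μ = 0 := by
      rw [integral_const_mul]
      have := integral_re ((site_int_id hδ hexp).1.const_mul (conj c))
      simp only [RCLike.re_eq_complex_re] at this
      rw [this, integral_const_mul, hmean]
      simp
    have := site_bound (μ := μ) (f := fun y => Real.exp (4 * (conj c * y).re)) (a := 1 - θ) (b := θ)
      (fun y => (Real.exp_pos _).le) hθ0 hYi hY0 (site_int hexp) hD (fun y => by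
        have h1 := exp_le_id_add (4 * (conj c * y).re)
        have h2 : Real.exp ((4 * (conj c * y).re) ^ 2) ≤ Real.exp (θ * (δ₀ * ‖y‖ ^ 2)) := by
          apply Real.exp_le_exp.mpr
          have e : θ * (δ₀ * ‖y‖ ^ 2) = (4 * (‖c‖ * ‖y‖)) ^ 2 := by
            rw [hθ]; field_simp; ring
          rw [e, mul_pow, mul_pow 4 (‖c‖ * ‖y‖)]
          have := sq_le_sq' (by linarith [(abs_le.mp (hre y)).1]) (abs_le.mp (hre y)).2
          gcongr 4 ^ 2 * ?_
        have h3 : Real.exp (θ * (δ₀ * ‖y‖ ^ 2)) ≤ (1 - θ) + θ * Real.exp (δ₀ * ‖y‖ ^ 2) := by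
          have := convexOn_exp.2 (Set.mem_univ 0) (Set.mem_univ (δ₀ * ‖y‖ ^ 2))
            (by linarith : 0 ≤ 1 - θ) hθ0 (by ring)
          simpa using this
        linarith)
    refine this.trans (ENNReal.ofReal_le_ofReal ?_)
    have h1 := Real.add_one_le_exp (θ * D + 4 * ‖c‖ ^ 2 / δ₀)
    have : 0 ≤ 4 * ‖c‖ ^ 2 / δ₀ := by positivity
    linarith
  · push Not at h
    have := site_bound (μ := μ) (f := fun y => Real.exp (4 * (conj c * y).re)) (Y := fun _ => 0)
      (a := 0) (b := Real.exp (4 * ‖c‖ ^ 2 / δ₀))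
      (fun y => (Real.exp_pos _).le) (Real.exp_pos _).le (integrable_zero _ _ _) (by simp)
      (site_int hexp) hD (fun y => by
        rw [zero_add, zero_add, ← Real.exp_add]
        apply Real.exp_le_exp.mpr
        have h1 := (abs_le.mp (hre y)).2
        have h2 : 4 * (‖c‖ * ‖y‖) ≤ 4 * ‖c‖ ^ 2 / δ₀ + δ₀ * ‖y‖ ^ 2 := by
          rw [div_add' _ _ _ hδ.ne', le_div_iff₀ hδ]
          nlinarith [sq_nonneg (2 * ‖c‖ - δ₀ * ‖y‖)]
        linarith)
    refine this.trans (ENNReal.ofReal_le_ofReal ?_)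
    rw [zero_add, add_comm, Real.exp_add]
    gcongr
    have h1 := Real.add_one_le_exp (θ * D)
    nlinarith

include hδ hvar hexp in
lemma site_quad (g : ℝ) (hg : |g| ≤ δ₀ / 8) : ∫⁻ y, ee (2 * (g * (‖y‖ ^ 2 - 1))) ∂μ ≤
    ee (128 * Real.exp (δ₀ / 2) / δ₀ ^ 2 * D * g ^ 2) := by
  obtain ⟨hD, hD1⟩ := site_D hδ hexp
  have hi := (site_int_id hδ hexp).2
  have := site_bound (μ := μ) (f := fun y => Real.exp (2 * (g * (‖y‖ ^ 2 - 1))))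
    (Y := fun y => 2 * (g * (‖y‖ ^ 2 - 1)))
    (a := 1) (b := 128 * Real.exp (δ₀ / 2) / δ₀ ^ 2 * g ^ 2)
    (fun y => (Real.exp_pos _).le) (by positivity)
    (((hi.sub (integrable_const 1)).const_mul g).const_mul 2) (by
      rw [integral_const_mul, integral_const_mul, integral_sub hi (integrable_const 1), hvar]; simp)
    (site_int hexp) hD (fun y => by
      have h1 := exp_le_quad (2 * (g * (‖y‖ ^ 2 - 1)))
      set X := ‖y‖ ^ 2 with hX
      have hX0 : 0 ≤ X := by positivity
      have h2 : |2 * (g * (X - 1))| ≤ 2 * |g| * (X + 1) := by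
        rw [abs_mul, abs_mul, abs_two, mul_assoc]
        gcongr
        rw [abs_le]; constructor <;> linarith
      have h3 : (2 * (g * (X - 1))) ^ 2 ≤ 4 * g ^ 2 * (X + 1) ^ 2 := by
        have : (X - 1) ^ 2 ≤ (X + 1) ^ 2 := by nlinarith
        nlinarith [mul_le_mul_of_nonneg_left this (sq_nonneg g)]
      have h4 : 2 * |g| * (X + 1) ≤ δ₀ / 4 * (X + 1) := by gcongr; linarith
      have h5 : (δ₀ / 4 * (X + 1)) ^ 2 / 2 ≤ Real.exp (δ₀ / 4 * (X + 1)) := by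
        have := Real.quadratic_le_exp_of_nonneg (x := δ₀ / 4 * (X + 1)) (by positivity)
        have : 0 ≤ δ₀ / 4 * (X + 1) := by positivity
        linarith
      have h6 : (X + 1) ^ 2 ≤ 32 / δ₀ ^ 2 * Real.exp (δ₀ / 4 * (X + 1)) := by
        rw [div_mul_eq_mul_div, le_div_iff₀ (by positivity)]
        nlinarith
      have h7 : (2 * (g * (X - 1))) ^ 2 * Real.exp |2 * (g * (X - 1))| ≤
          (4 * g ^ 2 * (32 / δ₀ ^ 2 * Real.exp (δ₀ / 4 * (X + 1)))) * Real.exp (δ₀ / 4 * (X + 1)) := by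
        gcongr
        · exact h3.trans (by gcongr)
        · exact h2.trans h4
      have h8 : Real.exp (δ₀ / 4 * (X + 1)) * Real.exp (δ₀ / 4 * (X + 1)) ≤
          Real.exp (δ₀ / 2) * Real.exp (δ₀ * X) := by
        rw [← Real.exp_add, ← Real.exp_add]
        apply Real.exp_le_exp.mpr
        nlinarith
      have h9 := mul_le_mul_of_nonneg_left h8 (by positivity : 0 ≤ 128 / δ₀ ^ 2 * g ^ 2)
      calc _ ≤ _ := h1
        _ ≤ 1 + 2 * (g * (X - 1)) + 128 / δ₀ ^ 2 * g ^ 2 * (Real.exp (δ₀ / 2) * Real.exp (δ₀ * X)) := by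
          have h10 : (4 * g ^ 2 * (32 / δ₀ ^ 2 * Real.exp (δ₀ / 4 * (X + 1)))) * Real.exp (δ₀ / 4 * (X + 1)) =
            128 / δ₀ ^ 2 * g ^ 2 * (Real.exp (δ₀ / 4 * (X + 1)) * Real.exp (δ₀ / 4 * (X + 1))) := by ring
          linarith
        _ = _ := by ring)
  refine this.trans (ENNReal.ofReal_le_ofReal ?_)
  have h1 := Real.add_one_le_exp (128 * Real.exp (δ₀ / 2) / δ₀ ^ 2 * D * g ^ 2)
  linarith

/-- constant in the single site bound -/
def CSG (δ₀ D : ℝ) : ℝ := 1 + (16 * D + 4) / δ₀ + 128 * Real.exp (δ₀ / 2) / δ₀ ^ 2 * D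

include hδ hmean hvar hexp in
lemma site_SG : SG μ (fun y => y) (CSG δ₀ D) (δ₀ / 8) := by
  obtain ⟨hD, hD1⟩ := site_D hδ hexp
  intro c g hg
  have hm1 : Measurable fun y : ℂ => ee (4 * (conj c * y).re) := measurable_ee.comp (by fun_prop)
  have hm2 : Measurable fun y : ℂ => ee (2 * (g * (‖y‖ ^ 2 - 1))) := measurable_ee.comp (by fun_prop)
  set V := CSG δ₀ D * (‖c‖ ^ 2 + g ^ 2)
  have h0 : 0 ≤ (16 * D + 4) / δ₀ := by positivity
  have h0' : 0 ≤ 128 * Real.exp (δ₀ / 2) / δ₀ ^ 2 * D := by positivity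
  have h1 : ∫⁻ y, ee (4 * (conj c * y).re) ∂μ ≤ ee V := by
    refine (site_linear hδ hmean hexp c).trans (ee_mono ?_)
    apply mul_le_mul _ _ (by positivity) _
    · rw [CSG]; linarith
    · nlinarith
    · rw [CSG]; linarith
  have h2 : ∫⁻ y, ee (2 * (g * (‖y‖ ^ 2 - 1))) ∂μ ≤ ee V := by
    refine (site_quad hδ hvar hexp g hg).trans (ee_mono ?_)
    apply mul_le_mul _ _ (by positivity) _
    · rw [CSG]; linarith
    · nlinarith [norm_nonneg c]
    · rw [CSG]; linarith
  calc _ ≤ ∫⁻ y, (ee (4 * (conj c * y).re) + ee (2 * (g * (‖y‖ ^ 2 - 1)))) / 2 ∂μ := by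
        apply lintegral_mono
        intro y
        have := ee_amgm (4 * (conj c * y).re) (2 * (g * (‖y‖ ^ 2 - 1)))
        rw [ENNReal.ofReal_div_of_pos (by norm_num), ENNReal.ofReal_add (Real.exp_pos _).le (Real.exp_pos _).le] at this
        simp only [ENNReal.ofReal_ofNat] at this
        refine le_trans (ee_mono (le_of_eq ?_)) this
        ring
    _ ≤ (ee V + ee V) / 2 := by
        simp_rw [div_eq_mul_inv]
        rw [lintegral_mul_const _ (by exact hm1.add hm2), lintegral_add_left hm1]
        gcongr
    _ = ee V := by
        rw [ENNReal.add_div, ENNReal.add_halves]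

include hδ hmean hvar hexp in
lemma site_SG_conj : SG μ (fun y => conj y) (CSG δ₀ D) (δ₀ / 8) := by
  intro c g hg
  have := site_SG hδ hmean hvar hexp (conj c) g hg
  rw [RCLike.norm_conj] at this
  refine le_trans (le_of_eq ?_) this
  congr 1
  funext y
  congr 3
  · rw [← Complex.conj_re (conj c * conj y), map_mul]; simp
  · simp
end single


lemma gauss_int {b : ℝ} (hb : 0 < b) : ∫⁻ t : ℂ, ee (-b * ‖t‖ ^ 2) = ENNReal.ofReal (Real.pi / b) := by
  have h := GaussianFourier.integral_rexp_neg_mul_sq_norm (V := ℂ) hb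
  rw [Complex.finrank_real_complex] at h
  norm_num at h
  have hi : Integrable (fun v : ℂ => Real.exp (-(b * ‖v‖ ^ 2))) := by
    apply Integrable.of_integral_ne_zero
    rw [h]; positivity
  have h2 := ofReal_integral_eq_lintegral_ofReal hi (Filter.Eventually.of_forall fun z => (Real.exp_pos _).le)
  rw [h] at h2
  rw [h2]
  simp only [ee, neg_mul]

lemma gauss_lin (l : ℂ) : ∫⁻ t : ℂ, ee (2 * (conj t * l).re - ‖t‖ ^ 2) = ee (‖l‖ ^ 2) * ENNReal.ofReal Real.pi := by
  have h1 : ∀ t : ℂ, ee (2 * (conj t * l).re - ‖t‖ ^ 2) = ee (‖l‖ ^ 2) * ee (-1 * ‖t - l‖ ^ 2) := by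
    intro t
    rw [← ee_add]
    congr 1
    rw [← Complex.normSq_eq_norm_sq, ← Complex.normSq_eq_norm_sq, ← Complex.normSq_eq_norm_sq,
      Complex.normSq_apply, Complex.normSq_apply, Complex.normSq_apply]
    simp
    ring
  simp_rw [h1]
  rw [lintegral_const_mul _ (by fun_prop),
    lintegral_sub_right_eq_self (fun t : ℂ => ee (-1 * ‖t‖ ^ 2)) l, gauss_int one_pos, div_one]

section hw
variable {ι : Type} [Fintype ι] [DecidableEq ι] {ρ : ι → Measure ℂ} [∀ i, IsProbabilityMeasure (ρ i)]

lemma supermart {n : ℕ} (p : Fin n → ι) (w : (ι → ℂ) → ℝ≥0∞) (f : Fin n → (ι → ℂ) → ℝ)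
    (hw : Measurable w) (hf : ∀ j, Measurable (f j))
    (hwi : ∀ j x y, w (Function.update x (p j) y) = w x)
    (h1 : ∀ i j, i < j → ∀ x y, f i (Function.update x (p j) y) = f i x)
    (h2 : ∀ j x, ∫⁻ y, ee (f j (Function.update x (p j) y)) ∂(ρ (p j)) ≤ 1) :
    ∫⁻ x, w x * ee (∑ j, f j x) ∂(Measure.pi ρ) ≤ ∫⁻ x, w x ∂(Measure.pi ρ) := by
  induction n with
  | zero => simp [ee_zero]
  | succ n ih =>
    have ih' := ih (fun j => p j.castSucc) (fun j => f j.castSucc) (fun j => hf _)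
      (fun j => hwi _) (fun i j hij => h1 _ _ (by simpa using hij)) (fun j => h2 _)
    refine le_trans ?_ ih'
    have hsum : Measurable fun x => ∑ j : Fin n, f j.castSucc x :=
      Finset.measurable_sum _ fun j _ => hf _
    apply lintegral_le_of_lmarginal_le {p (Fin.last n)}
    · exact hw.mul (measurable_ee.comp (Finset.measurable_sum _ fun j _ => hf _))
    · exact hw.mul (measurable_ee.comp hsum)
    · intro x
      rw [lmarginal_singleton, lmarginal_singleton]
      have e : ∀ y, ∑ j : Fin n, f j.castSucc (Function.update x (p (Fin.last n)) y) =
          ∑ j : Fin n, f j.castSucc x := fun y =>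
        Finset.sum_congr rfl fun j _ => h1 _ _ (Fin.castSucc_lt_last j) _ _
      simp only [hwi, Fin.sum_univ_castSucc, e, ee_add]
      rw [lintegral_const_mul _ (by
        apply Measurable.const_mul
        exact measurable_ee.comp ((hf _).comp (measurable_update x))), lintegral_const_mul _ (by
        exact measurable_ee.comp ((hf _).comp (measurable_update x)))]
      simp only [lintegral_const, measure_univ, mul_one]
      calc _ ≤ w x * (ee (∑ j : Fin n, f j.castSucc x) * 1) := by gcongr; exact h2 _ _
        _ = _ := by rw [mul_one]

variable {N : ℕ} {p : Fin N → ι} {φ : Fin N → ℂ → ℂ} {k : Fin N} {C g₀ : ℝ}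
  (hp : Function.Injective p) (hφ : ∀ j, Measurable (φ j))
  (hSG : ∀ j, j ≠ k → SG (ρ (p j)) (φ j) C g₀) (hg : 0 ≤ g₀) (hC : 1 ≤ C)

include hp in
omit [Fintype ι] in
lemma u_upd (i j : Fin N) (hij : i ≠ j) (x : ι → ℂ) (y : ℂ) :
    φ i (Function.update x (p j) y (p i)) = φ i (x (p i)) := by
  rw [Function.update_of_ne]
  exact fun h => hij (hp h)

include hp hφ hSG hg hC in
lemma lin_bound (w : (ι → ℂ) → ℝ≥0∞) (hw : Measurable w)
    (hwi : ∀ j x y, w (Function.update x (p j) y) = w x)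
    (a : Fin N → (ι → ℂ) → ℂ) (ha : ∀ i, Measurable (a i))
    (hai : ∀ i j x y, a i (Function.update x (p j) y) = a i x) (hak : ∀ x, a k x = 0)
    {s : ℝ} (hs : ∀ x, ∑ i, ‖a i x‖ ^ 2 ≤ s) (t : ℂ) :
    ∫⁻ x, w x * ee (2 * (conj t * ∑ i, a i x * φ i (x (p i))).re) ∂(Measure.pi ρ) ≤
      ee (C * ‖t‖ ^ 2 * s) * ∫⁻ x, w x ∂(Measure.pi ρ) := by
  have h := supermart (ρ := ρ) p w (fun i x => 2 * (conj t * (a i x * φ i (x (p i)))).re - C * ‖t‖ ^ 2 * ‖a i x‖ ^ 2)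
    hw (fun i => by have := ha i; have := hφ i; fun_prop) hwi (fun i j hij x y => by
      simp only [hai, u_upd hp i j hij.ne]) (fun j x => by
      simp only [hai, Function.update_self]
      by_cases hj : j = k
      · subst hj; simp [hak, ee_zero]
      · have h1 := hSG j hj (t * conj (a j x)) 0 (by simpa using hg)
        have e : ∀ y, ee (2 * (conj t * (a j x * φ j y)).re - C * ‖t‖ ^ 2 * ‖a j x‖ ^ 2) =
            ee (2 * (conj (t * conj (a j x)) * φ j y).re + 0 * (‖φ j y‖ ^ 2 - 1)) * ee (-(C * ‖t‖ ^ 2 * ‖a j x‖ ^ 2)) := by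
          intro y
          rw [← ee_add]; congr 1; rw [map_mul, Complex.conj_conj, mul_assoc]; ring
        simp_rw [e]
        rw [lintegral_mul_const _ (by have := hφ j; fun_prop)]
        calc _ ≤ ee (C * (‖t * conj (a j x)‖ ^ 2 + 0 ^ 2)) * ee (-(C * ‖t‖ ^ 2 * ‖a j x‖ ^ 2)) := by gcongr
          _ = 1 := by
            rw [← ee_add, ← ee_zero]; congr 1
            rw [norm_mul, RCLike.norm_conj]; ring)
  calc _ ≤ ∫⁻ x, ee (C * ‖t‖ ^ 2 * s) * (w x * ee (∑ i, (2 * (conj t * (a i x * φ i (x (p i)))).re - C * ‖t‖ ^ 2 * ‖a i x‖ ^ 2))) ∂(Measure.pi ρ) := by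
        apply lintegral_mono
        intro x
        change _ ≤ ee (C * ‖t‖ ^ 2 * s) * (w x * ee (∑ i, (2 * (conj t * (a i x * φ i (x (p i)))).re - C * ‖t‖ ^ 2 * ‖a i x‖ ^ 2)))
        rw [mul_left_comm, ← ee_add]
        refine mul_le_mul_right (ee_mono ?_) _
        rw [Finset.sum_sub_distrib, Finset.mul_sum, Complex.re_sum, Finset.mul_sum, ← Finset.mul_sum (f := fun i => ‖a i x‖ ^ 2)]
        have := mul_le_mul_of_nonneg_left (hs x) (by positivity : 0 ≤ C * ‖t‖ ^ 2)
        linarith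
    _ ≤ _ := by
        rw [lintegral_const_mul']
        · gcongr
        · exact ee_ne_top _

include hp hφ hSG hg hC in
lemma gauss_bound (w : (ι → ℂ) → ℝ≥0∞) (hw : Measurable w)
    (hwi : ∀ j x y, w (Function.update x (p j) y) = w x)
    (a : Fin N → (ι → ℂ) → ℂ) (ha : ∀ i, Measurable (a i))
    (hai : ∀ i j x y, a i (Function.update x (p j) y) = a i x) (hak : ∀ x, a k x = 0)
    {s : ℝ} (hs : ∀ x, ∑ i, ‖a i x‖ ^ 2 ≤ s) (hCs : C * s ≤ 1 / 2) :
    ∫⁻ x, w x * ee (‖∑ i, a i x * φ i (x (p i))‖ ^ 2) ∂(Measure.pi ρ) ≤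
      2 * ∫⁻ x, w x ∂(Measure.pi ρ) := by
  have hpi : ENNReal.ofReal Real.pi ≠ 0 := by simp [Real.pi_pos]
  have hl : Measurable fun x : ι → ℂ => ∑ i, a i x * φ i (x (p i)) :=
    Finset.measurable_sum _ fun i _ => by have := ha i; have := hφ i; fun_prop
  have e : ∀ x, w x * ee (‖∑ i, a i x * φ i (x (p i))‖ ^ 2) * ENNReal.ofReal Real.pi =
      ∫⁻ t : ℂ, w x * ee (2 * (conj t * ∑ i, a i x * φ i (x (p i))).re - ‖t‖ ^ 2) := by
    intro x
    rw [lintegral_const_mul _ (by fun_prop), gauss_lin, mul_assoc]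
  rw [← ENNReal.mul_le_mul_iff_left hpi ENNReal.ofReal_ne_top,
    ← lintegral_mul_const _ (by fun_prop)]
  simp_rw [e]
  rw [lintegral_lintegral_swap]
  · calc _ ≤ ∫⁻ t : ℂ, ee (-(1/2) * ‖t‖ ^ 2) * ∫⁻ x, w x ∂(Measure.pi ρ) := by
          apply lintegral_mono
          intro t
          have h := lin_bound hp hφ hSG hg hC w hw hwi a ha hai hak hs t
          have e2 : ∀ x, w x * ee (2 * (conj t * ∑ i, a i x * φ i (x (p i))).re - ‖t‖ ^ 2) =
            ee (-‖t‖ ^ 2) * (w x * ee (2 * (conj t * ∑ i, a i x * φ i (x (p i))).re)) := by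
            intro x; rw [mul_left_comm, ← ee_add]; ring_nf
          simp_rw [e2]
          rw [lintegral_const_mul' _ _ (ee_ne_top _)]
          calc _ ≤ ee (-‖t‖ ^ 2) * (ee (C * ‖t‖ ^ 2 * s) * ∫⁻ x, w x ∂(Measure.pi ρ)) := by gcongr
            _ ≤ _ := by
              rw [← mul_assoc, ← ee_add]
              gcongr
              apply ee_mono
              nlinarith [mul_le_mul_of_nonneg_right hCs (sq_nonneg ‖t‖)]
    _ = _ := by
          rw [lintegral_mul_const _ (by fun_prop), gauss_int (by norm_num)]
          have : ENNReal.ofReal (Real.pi / (1 / 2)) = 2 * ENNReal.ofReal Real.pi := by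
            rw [show Real.pi / (1 / 2) = 2 * Real.pi by ring, ENNReal.ofReal_mul (by norm_num)]
            simp
          rw [this]; ring
  · apply Measurable.aemeasurable
    apply Measurable.mul (hw.comp measurable_fst)
    apply measurable_ee.comp
    have : Measurable fun q : (ι → ℂ) × ℂ => ∑ i, a i q.1 * φ i (q.1 (p i)) := hl.comp measurable_fst
    fun_prop
end hw


lemma jensen_w {N : ℕ} {C : ℝ} (hC : 0 ≤ C) (b : Fin N → ℝ) (hb : ∀ j, 0 ≤ b j) (y : Fin N → ℝ)
    (hy : ∀ j, b j = 0 → y j = 0) :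
    Real.exp (C * ∑ j, y j) ≤ 1 + ∑ j, (b j / ∑ i, b i) * Real.exp (C * (∑ i, b i) / b j * y j) := by
  set B := ∑ i, b i with hB
  have hBn : 0 ≤ B := Finset.sum_nonneg fun i _ => hb i
  rcases hBn.eq_or_lt with h0 | hpos
  · have hz : ∀ j, b j = 0 := by
      intro j
      exact (Finset.sum_eq_zero_iff_of_nonneg fun i _ => hb i).mp h0.symm j (Finset.mem_univ j)
    have : ∑ j, y j = 0 := Finset.sum_eq_zero fun j _ => hy j (hz j)
    rw [this]; simp [hz]
  · have h := convexOn_exp.map_sum_le (t := Finset.univ) (w := fun j : Fin N => b j / B)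
      (p := fun j => C * B / b j * y j) (fun j _ => div_nonneg (hb j) hBn) (by
        rw [← Finset.sum_div, ← hB, div_self hpos.ne']) (fun j _ => Set.mem_univ _)
    have e : ∑ j : Fin N, (b j / B) • (C * B / b j * y j) = C * ∑ j, y j := by
      simp only [smul_eq_mul]
      rw [Finset.mul_sum Finset.univ y C]
      apply Finset.sum_congr rfl
      intro j _
      by_cases hj : b j = 0
      · rw [hy j hj]; simp
      · field_simp
    rw [e] at h
    simp only [smul_eq_mul] at h
    linarith

lemma sum_split {N : ℕ} (R : Fin N → Fin N → ℝ) :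
    ∑ i, ∑ j, R i j = ∑ j, (R j j + ∑ i, if i < j then R j i + R i j else 0) := by
  have h : ∀ i j, R i j = (if i < j then R i j else 0) + (if j < i then R i j else 0) + (if j = i then R i j else 0) := by
    intro i j
    rcases lt_trichotomy i j with h | h | h
    · simp [h, h.ne', h.not_gt]
    · subst h; simp
    · simp [h, h.ne, h.not_gt]
  have h2 : ∑ i, ∑ j, R i j = ∑ i, ∑ j, ((if i < j then R i j else 0) + (if j < i then R i j else 0) + (if j = i then R i j else 0)) :=
    Finset.sum_congr rfl fun i _ => Finset.sum_congr rfl fun j _ => h i j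
  have h3 : ∀ i j, (if i < j then R j i + R i j else 0) = (if i < j then R j i else 0) + (if i < j then R i j else 0) := by
    intro i j; split_ifs <;> simp
  rw [h2]
  simp only [h3, Finset.sum_add_distrib, Finset.sum_ite_eq', Finset.sum_ite_eq, Finset.mem_univ, if_true]
  rw [Finset.sum_comm (f := fun i j => if i < j then R i j else 0)]
  ring

section hw
variable {ι : Type} [Fintype ι] [DecidableEq ι] {ρ : ι → Measure ℂ} [∀ i, IsProbabilityMeasure (ρ i)]
variable {N : ℕ} {p : Fin N → ι} {φ : Fin N → ℂ → ℂ} {k : Fin N} {C g₀ : ℝ}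
  (hp : Function.Injective p) (hφ : ∀ j, Measurable (φ j))
  (hSG : ∀ j, j ≠ k → SG (ρ (p j)) (φ j) C g₀) (hg : 0 ≤ g₀) (hC : 1 ≤ C)

include hp hφ hSG hg hC in
lemma V_bound (A : Fin N → Fin N → (ι → ℂ) → ℂ) (hA : ∀ j i, Measurable (A j i))
    (hAi : ∀ j i l x y, A j i (Function.update x (p l) y) = A j i x) (hAk : ∀ j x, A j k x = 0)
    {c : ℝ} (hs : ∀ x, ∑ j, ∑ i, ‖A j i x‖ ^ 2 ≤ c ^ 2) (hc : C * c ≤ 1 / 2) (hc0 : 0 ≤ c) :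
    ∫⁻ x, ee (C * ∑ j, ‖∑ i, A j i x * φ i (x (p i))‖ ^ 2) ∂(Measure.pi ρ) ≤ 3 := by
  set b : Fin N → (ι → ℂ) → ℝ := fun j x => ∑ i, ‖A j i x‖ ^ 2 with hb
  have hb0 : ∀ j x, 0 ≤ b j x := fun j x => Finset.sum_nonneg fun i _ => by positivity
  have hbm : ∀ j, Measurable (b j) := fun j => Finset.measurable_sum _ fun i _ => by
    have := hA j i; fun_prop
  have hBm : Measurable fun x => ∑ j, b j x := Finset.measurable_sum _ fun j _ => hbm j
  set a : Fin N → Fin N → (ι → ℂ) → ℂ := fun j i x => (√(C * (∑ l, b l x) / b j x) : ℂ) * A j i x with ha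
  set w : Fin N → (ι → ℂ) → ℝ≥0∞ := fun j x => ENNReal.ofReal (b j x / ∑ l, b l x) with hw
  have hwm : ∀ j, Measurable (w j) := fun j => by
    have := hbm j; rw [hw]; fun_prop
  have ham : ∀ j i, Measurable (a j i) := fun j i => by
    have := hbm j; have := hA j i; rw [ha]; fun_prop
  have hbi : ∀ j l x y, b j (Function.update x (p l) y) = b j x := fun j l x y => by
    simp only [hb, hAi]
  have hB0 : ∀ x, 0 ≤ ∑ l, b l x := fun x => Finset.sum_nonneg fun i _ => hb0 _ _
  have hasum : ∀ j x, ∑ i, ‖a j i x‖ ^ 2 ≤ C * c ^ 2 := by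
    intro j x
    have e : ∀ i, ‖a j i x‖ ^ 2 = (C * (∑ l, b l x) / b j x) * ‖A j i x‖ ^ 2 := by
      intro i
      rw [ha]
      simp only [norm_mul, Complex.norm_real, mul_pow, Real.norm_eq_abs, sq_abs]
      rw [Real.sq_sqrt]
      exact div_nonneg (mul_nonneg (by linarith) (hB0 x)) (hb0 j x)
    rw [Finset.sum_congr rfl fun i _ => e i, ← Finset.mul_sum]
    change C * (∑ l, b l x) / b j x * b j x ≤ _
    by_cases h0 : b j x = 0
    · rw [h0]; simp; positivity
    · rw [div_mul_cancel₀ _ h0]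
      have := hs x
      gcongr
  have hmain : ∀ x, ee (C * ∑ j, ‖∑ i, A j i x * φ i (x (p i))‖ ^ 2) ≤
      1 + ∑ j, w j x * ee (‖∑ i, a j i x * φ i (x (p i))‖ ^ 2) := by
    intro x
    have h := jensen_w (by linarith : 0 ≤ C) (fun j => b j x) (fun j => hb0 j x)
      (fun j => ‖∑ i, A j i x * φ i (x (p i))‖ ^ 2) (fun j hj => by
        have : ∀ i, A j i x = 0 := fun i => by
          have := (Finset.sum_eq_zero_iff_of_nonneg fun i _ => by positivity).mp hj i (Finset.mem_univ i)
          simpa using this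
        simp [this])
    refine (ENNReal.ofReal_le_ofReal h).trans ?_
    have hnn : ∀ j ∈ Finset.univ, 0 ≤ b j x / (∑ l, b l x) * Real.exp (C * (∑ l, b l x) / b j x * ‖∑ i, A j i x * φ i (x (p i))‖ ^ 2) :=
      fun j _ => mul_nonneg (div_nonneg (hb0 j x) (hB0 x)) (Real.exp_pos _).le
    rw [ENNReal.ofReal_add zero_le_one (Finset.sum_nonneg hnn), ENNReal.ofReal_one,
      ENNReal.ofReal_sum_of_nonneg hnn]
    gcongr with j
    rw [ENNReal.ofReal_mul (div_nonneg (hb0 j x) (hB0 x))]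
    change w j x * ee _ ≤ _
    refine le_of_eq ?_
    congr 2
    have e : ∑ i, a j i x * φ i (x (p i)) = (√(C * (∑ l, b l x) / b j x) : ℂ) * ∑ i, A j i x * φ i (x (p i)) := by
      rw [Finset.mul_sum]
      refine Finset.sum_congr rfl fun i _ => ?_
      rw [ha]; ring
    rw [e, norm_mul, mul_pow, Complex.norm_real, Real.norm_eq_abs, sq_abs, Real.sq_sqrt]
    exact div_nonneg (mul_nonneg (by linarith) (hB0 x)) (hb0 j x)
  have hterm : ∀ j, Measurable fun x : ι → ℂ => w j x * ee (‖∑ i, a j i x * φ i (x (p i))‖ ^ 2) := by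
    intro j
    have : Measurable fun x : ι → ℂ => ∑ i, a j i x * φ i (x (p i)) :=
      Finset.measurable_sum _ fun i _ => by have := ham j i; have := hφ i; fun_prop
    have := hwm j
    fun_prop
  calc _ ≤ ∫⁻ x, (1 + ∑ j, w j x * ee (‖∑ i, a j i x * φ i (x (p i))‖ ^ 2)) ∂(Measure.pi ρ) :=
        lintegral_mono hmain
    _ = 1 + ∑ j, ∫⁻ x, w j x * ee (‖∑ i, a j i x * φ i (x (p i))‖ ^ 2) ∂(Measure.pi ρ) := by
        rw [lintegral_add_left measurable_const, lintegral_finsetSum _ fun j _ => hterm j]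
        simp
    _ ≤ 1 + ∑ j, 2 * ∫⁻ x, w j x ∂(Measure.pi ρ) := by
        gcongr with j
        refine gauss_bound hp hφ hSG hg hC (w j) (hwm j) (fun l x y => by simp only [hw, hbi])
          (a j) (ham j) (fun i l x y => by simp only [ha, hbi, hAi]) (fun x => by simp [ha, hAk])
          (hasum j) ?_
        nlinarith [mul_nonneg (by linarith : 0 ≤ C) hc0]
    _ = 1 + 2 * ∫⁻ x, ∑ j, w j x ∂(Measure.pi ρ) := by
        rw [lintegral_finsetSum _ fun j _ => hwm j, Finset.mul_sum]
    _ ≤ 1 + 2 * ∫⁻ x, 1 ∂(Measure.pi ρ) := by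
        gcongr with x
        rw [hw, ← ENNReal.ofReal_sum_of_nonneg fun j _ => div_nonneg (hb0 j x) (hB0 x), ← Finset.sum_div]
        rw [← ENNReal.ofReal_one]
        exact ENNReal.ofReal_le_ofReal (div_self_le_one _)
    _ = 3 := by simp; norm_num

include hp hφ hSG hg hC in
lemma hw_re (S : (ι → ℂ) → Matrix (Fin N) (Fin N) ℂ) (hS : ∀ i j, Measurable fun x => S x i j)
    (hSi : ∀ l x y, S (Function.update x (p l) y) = S x) (hSk : ∀ x i, S x k i = 0 ∧ S x i k = 0)
    {c : ℝ} (hs : ∀ x, ∑ i, ∑ j, ‖S x i j‖ ^ 2 ≤ c ^ 2) (hc : C * c ≤ 1 / 2) (hc0 : 0 ≤ c) (hcg : c ≤ g₀) :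
    ∫⁻ x, ee ((∑ i, ∑ j, conj (φ i (x (p i))) * S x i j * φ j (x (p j)) - ∑ i, S x i i).re / 2)
      ∂(Measure.pi ρ) ≤ 1 + 3 * ee 1 := by
  set A : Fin N → Fin N → (ι → ℂ) → ℂ := fun j i x => if i < j then (S x j i + conj (S x i j)) / 2 else 0 with hA
  have hAm : ∀ j i, Measurable (A j i) := fun j i => by
    have h1 := hS j i; have h2 := hS i j
    simp only [hA]; split_ifs
    · fun_prop
    · fun_prop
  have hAi : ∀ j i l x y, A j i (Function.update x (p l) y) = A j i x := fun j i l x y => by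
    simp only [hA, hSi]
  have hAk : ∀ j x, A j k x = 0 := fun j x => by simp [hA, (hSk x j).1, (hSk x j).2]
  have hAs : ∀ x, ∑ j, ∑ i, ‖A j i x‖ ^ 2 ≤ c ^ 2 := by
    intro x
    refine le_trans ?_ (hs x)
    have h1 : ∀ j i, ‖A j i x‖ ^ 2 ≤ (‖S x j i‖ ^ 2 + ‖S x i j‖ ^ 2) / 2 := by
      intro j i
      simp only [hA]
      split_ifs
      · rw [norm_div, div_pow]
        have h2 := norm_add_le (S x j i) (conj (S x i j))
        rw [RCLike.norm_conj] at h2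
        have h3 : ‖(2 : ℂ)‖ = 2 := by simp
        rw [h3]
        have h4 := pow_le_pow_left₀ (norm_nonneg _) h2 2
        nlinarith [sq_nonneg (‖S x j i‖ - ‖S x i j‖)]
      · simp; positivity
    calc _ ≤ ∑ j, ∑ i, (‖S x j i‖ ^ 2 + ‖S x i j‖ ^ 2) / 2 :=
          Finset.sum_le_sum fun j _ => Finset.sum_le_sum fun i _ => h1 j i
      _ = _ := by
          simp only [← Finset.sum_div, Finset.sum_add_distrib]
          rw [Finset.sum_comm (f := fun j i => ‖S x i j‖ ^ 2)]
          ring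
  set u : (ι → ℂ) → Fin N → ℂ := fun x i => φ i (x (p i)) with hu
  set cc : Fin N → (ι → ℂ) → ℂ := fun j x => ∑ i, A j i x * u x i with hcc
  have hum : ∀ j, Measurable fun x => u x j := fun j => by
    have := hφ j; simp only [hu]; fun_prop
  have hccm : ∀ j, Measurable (cc j) := fun j => Finset.measurable_sum _ fun i _ => by
    have := hum i; have := hAm j i; fun_prop
  have hcci : ∀ i j, i ≤ j → ∀ x y, cc i (Function.update x (p j) y) = cc i x := by
    intro i j hij x y
    simp only [hcc, hAi]
    refine Finset.sum_congr rfl fun l _ => ?_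
    by_cases hl : l < i
    · simp only [hu]; rw [u_upd (φ := φ) hp l j (hl.trans_le hij).ne]
    · simp [hA, hl]
  have hg' : ∀ x j, |(S x j j).re| ≤ c := by
    intro x j
    refine (Complex.abs_re_le_norm _).trans ?_
    apply le_of_sq_le_sq _ hc0
    refine le_trans ?_ (hs x)
    refine le_trans ?_ (Finset.single_le_sum (f := fun i => ∑ j, ‖S x i j‖ ^ 2) (fun i _ => Finset.sum_nonneg fun i _ => by positivity) (Finset.mem_univ j))
    exact Finset.single_le_sum (f := fun i => ‖S x j i‖ ^ 2) (fun i _ => by positivity) (Finset.mem_univ j)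
  have hdiag : ∀ x, ∑ j, ((S x j j).re) ^ 2 ≤ c ^ 2 := by
    intro x
    refine le_trans ?_ (hs x)
    refine Finset.sum_le_sum fun j _ => ?_
    refine le_trans ?_ (Finset.single_le_sum (f := fun i => ‖S x j i‖ ^ 2) (fun i _ => by positivity) (Finset.mem_univ j))
    have := Complex.abs_re_le_norm (S x j j)
    rw [← sq_abs]
    gcongr
  have hid : ∀ x, (∑ i, ∑ j, conj (u x i) * S x i j * u x j - ∑ i, S x i i).re =
      ∑ j, (2 * (conj (cc j x) * u x j).re + (S x j j).re * (‖u x j‖ ^ 2 - 1)) := by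
    intro x
    have h1 := sum_split (fun i j => (conj (u x i) * S x i j * u x j).re)
    simp only [Complex.sub_re, Complex.re_sum]
    rw [h1, ← Finset.sum_sub_distrib]
    refine Finset.sum_congr rfl fun j _ => ?_
    have h2 : (conj (u x j) * S x j j * u x j).re = (S x j j).re * ‖u x j‖ ^ 2 := by
      rw [← Complex.normSq_eq_norm_sq, Complex.normSq_apply]; simp; ring
    have h3 : 2 * (conj (cc j x) * u x j).re = ∑ i, if i < j then (conj (u x j) * S x j i * u x i).re + (conj (u x i) * S x i j * u x j).re else 0 := by
      simp only [hcc, map_sum, Finset.sum_mul, Complex.re_sum, Finset.mul_sum]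
      refine Finset.sum_congr rfl fun i _ => ?_
      simp only [hA]
      split_ifs
      · have h4 : conj ((S x j i + conj (S x i j)) / 2 * u x i) * u x j =
            (conj (conj (u x j) * S x j i * u x i) + conj (u x i) * S x i j * u x j) / 2 := by
          simp only [map_mul, map_div₀, map_add, Complex.conj_conj, Complex.conj_ofNat]
          ring
        rw [h4]
        have h5 : ∀ q : ℂ, (q / 2).re = q.re / 2 := fun q => by
          rw [show (2 : ℂ) = ((2 : ℝ) : ℂ) by norm_num, Complex.div_ofReal_re]
        rw [h5, Complex.add_re, Complex.conj_re]; ring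
      · simp
    rw [h2, h3]; ring
  have h := supermart (ρ := ρ) p (fun _ => 1) (fun j x => 2 * (conj (cc j x) * u x j).re +
      (S x j j).re * (‖u x j‖ ^ 2 - 1) - C * (‖cc j x‖ ^ 2 + (S x j j).re ^ 2)) measurable_const
    (fun j => by
      have := hccm j; have := hum j; have := hS j j
      fun_prop) (fun _ _ _ => rfl) (fun i j hij x y => by
      simp only [hSi, hcci i j hij.le]
      simp only [hu]
      rw [u_upd (φ := φ) hp i j hij.ne]) (fun j x => by
      simp only [hSi, hcci j j le_rfl]
      simp only [hu, Function.update_self]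
      by_cases hj : j = k
      · subst hj
        have : cc j x = 0 := by simp [hcc, hA, (hSk x _).1, (hSk x _).2]
        simp [this, (hSk x j).1, ee_zero]
      · have h1 := hSG j hj (cc j x) (S x j j).re ((hg' x j).trans hcg)
        have := hφ j
        simp_rw [sub_eq_add_neg _ (C * (‖cc j x‖ ^ 2 + (S x j j).re ^ 2)), ee_add _ (-(C * (‖cc j x‖ ^ 2 + (S x j j).re ^ 2)))]
        rw [lintegral_mul_const _ (by fun_prop)]
        calc _ ≤ ee (C * (‖cc j x‖ ^ 2 + (S x j j).re ^ 2)) * ee (-(C * (‖cc j x‖ ^ 2 + (S x j j).re ^ 2))) := by gcongr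
          _ = 1 := by rw [← ee_add, ← ee_zero]; congr 1; ring)
  have hV := V_bound hp hφ hSG hg hC A hAm hAi hAk hAs hc hc0
  simp only [one_mul, lintegral_const, measure_univ, mul_one] at h
  have hm1 : Measurable fun x => ∑ j, (2 * (conj (cc j x) * u x j).re +
      (S x j j).re * (‖u x j‖ ^ 2 - 1) - C * (‖cc j x‖ ^ 2 + (S x j j).re ^ 2)) :=
    Finset.measurable_sum _ fun j _ => by
      have := hccm j; have := hum j; have := hS j j
      fun_prop
  calc _ ≤ ∫⁻ x, (ee (∑ j, (2 * (conj (cc j x) * u x j).re +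
      (S x j j).re * (‖u x j‖ ^ 2 - 1) - C * (‖cc j x‖ ^ 2 + (S x j j).re ^ 2))) +
        ee (C * ∑ j, ‖cc j x‖ ^ 2) * ee 1) ∂(Measure.pi ρ) := by
        apply lintegral_mono
        intro x
        refine le_trans ?_ ((ee_half _ (C * ∑ j, (‖cc j x‖ ^ 2 + (S x j j).re ^ 2))).trans (add_le_add le_rfl ?_))
        · apply ee_mono
          rw [Finset.sum_sub_distrib, ← hid x, Finset.mul_sum]
          simp [hu]
        · rw [← ee_add]
          apply ee_mono
          rw [Finset.sum_add_distrib, mul_add]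
          gcongr
          have := hdiag x
          calc C * ∑ j, (S x j j).re ^ 2 ≤ C * c ^ 2 := by gcongr
            _ ≤ 1 := by nlinarith [mul_nonneg (by linarith : 0 ≤ C) hc0]
    _ ≤ 1 + 3 * ee 1 := by
        rw [lintegral_add_left (by fun_prop), lintegral_mul_const' _ _ (ee_ne_top _)]
        gcongr

include hp hφ hSG hg hC in
/-- Hanson-Wright type bound -/
lemma hw_norm (S : (ι → ℂ) → Matrix (Fin N) (Fin N) ℂ) (hS : ∀ i j, Measurable fun x => S x i j)
    (hSi : ∀ l x y, S (Function.update x (p l) y) = S x) (hSk : ∀ x i, S x k i = 0 ∧ S x i k = 0)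
    {c : ℝ} (hs : ∀ x, ∑ i, ∑ j, ‖S x i j‖ ^ 2 ≤ c ^ 2) (hc : C * c ≤ 1 / 2) (hc0 : 0 ≤ c) (hcg : c ≤ g₀) :
    ∫⁻ x, ee (‖∑ i, ∑ j, conj (φ i (x (p i))) * S x i j * φ j (x (p j)) - ∑ i, S x i i‖ / 4)
      ∂(Measure.pi ρ) ≤ 4 * (1 + 3 * ee 1) := by
  set X : (ι → ℂ) → ℂ := fun x => ∑ i, ∑ j, conj (φ i (x (p i))) * S x i j * φ j (x (p j)) - ∑ i, S x i i with hX
  have hXm : Measurable X := by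
    apply Measurable.sub
    · refine Finset.measurable_sum _ fun i _ => Finset.measurable_sum _ fun j _ => ?_
      have := hS i j; have := hφ i; have := hφ j; fun_prop
    · exact Finset.measurable_sum _ fun i _ => hS i i
  have key : ∀ ω : ℂ, ‖ω‖ = 1 → ∫⁻ x, ee ((ω * X x).re / 2) ∂(Measure.pi ρ) ≤ 1 + 3 * ee 1 := by
    intro ω hω
    have h := hw_re hp hφ hSG hg hC (fun x => ω • S x) (fun i j => by
      have := hS i j; simp only [Matrix.smul_apply, smul_eq_mul]; fun_prop) (fun l x y => by simp only [hSi])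
      (fun x i => by simp [(hSk x i).1, (hSk x i).2]) (fun x => by
        simpa [hω] using hs x) hc hc0 hcg
    refine le_trans (le_of_eq ?_) h
    congr 1
    funext x
    congr 3
    rw [hX]
    simp only [Matrix.smul_apply, smul_eq_mul, mul_sub, Finset.mul_sum]
    congr 1
    refine Finset.sum_congr rfl fun i _ => Finset.sum_congr rfl fun j _ => ?_
    ring
  have k1 := key 1 (by simp)
  have k2 := key (-1) (by simp)
  have k3 := key Complex.I (by simp)
  have k4 := key (-Complex.I) (by simp)
  calc _ ≤ ∫⁻ x, (ee ((1 * X x).re / 2) + (ee ((-1 * X x).re / 2) + (ee ((Complex.I * X x).re / 2) + ee ((-Complex.I * X x).re / 2)))) ∂(Measure.pi ρ) := by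
        apply lintegral_mono
        intro x
        have h1 := Complex.norm_le_abs_re_add_abs_im (X x)
        have h2 : ee (‖X x‖ / 4) ≤ ee (|(X x).re| / 2) + ee (|(X x).im| / 2) := by
          refine le_trans (ee_mono ?_) (ee_half _ _)
          linarith
        refine h2.trans ?_
        beta_reduce
        rw [← add_assoc]
        gcongr
        · rcases abs_cases (X x).re with h | h <;> rw [h.1]
          · exact le_trans (ee_mono (by simp)) le_self_add
          · exact le_trans (ee_mono (by simp)) le_add_self
        · rcases abs_cases (X x).im with h | h <;> rw [h.1]
          · exact le_trans (ee_mono (by simp)) le_add_self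
          · exact le_trans (ee_mono (by simp)) le_self_add
    _ ≤ (1 + 3 * ee 1) + ((1 + 3 * ee 1) + ((1 + 3 * ee 1) + (1 + 3 * ee 1))) := by
        rw [lintegral_add_left (by fun_prop), lintegral_add_left (by fun_prop), lintegral_add_left (by fun_prop)]
        gcongr
    _ = _ := by ring
end hw


/-- index set of upper triangle -/
abbrev PIdx (N : ℕ) := {p : Fin N × Fin N // p.1 ≤ p.2}

/-- Wigner matrix from its upper triangle -/
def wig {N : ℕ} (W : PIdx N → ℂ) : Matrix (Fin N) (Fin N) ℂ := fun i j =>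
  if h : i < j then W ⟨(i, j), h.le⟩ / (√(N : ℝ) : ℂ)
  else if h : j < i then conj (W ⟨(j, i), h.le⟩) / (√(N : ℝ) : ℂ)
  else ((W ⟨(i, i), le_rfl⟩).re : ℂ) / (√(N : ℝ) : ℂ)

/-- column index -/
def pcol {N : ℕ} (k j : Fin N) : PIdx N := ⟨(min j k, max j k), min_le_max⟩

/-- column transformation -/
def fcol {N : ℕ} (k j : Fin N) : ℂ → ℂ := if j < k then fun y => y else fun y => conj y

/-- error term in the self-consistent equation -/
def eps {N : ℕ} (k : Fin N) (A : Matrix (Fin N) (Fin N) ℂ) (z : ℂ) : ℂ :=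
  (rsv A z k k)⁻¹ + z + stTrans A z

section
variable {N : ℕ}

lemma wig_herm (W : PIdx N → ℂ) : (wig W).IsHermitian := by
  ext i j
  rw [Matrix.conjTranspose_apply]
  simp only [wig]
  rcases lt_trichotomy i j with h | h | h
  · simp [h, h.not_gt]
  · subst h; simp
  · simp [h, h.not_gt]

lemma wig_cont (i j : Fin N) : Continuous fun W : PIdx N → ℂ => wig W i j := by
  simp only [wig]
  split_ifs
  · fun_prop
  · exact (Complex.continuous_conj.comp (continuous_apply _)).div_const _
  · exact (Complex.continuous_ofReal.comp (Complex.continuous_re.comp (continuous_apply _))).div_const _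

lemma inv_meas {α : Type} [TopologicalSpace α] [MeasurableSpace α] [BorelSpace α]
    (A : α → Matrix (Fin N) (Fin N) ℂ) (hA : Continuous A) (i j : Fin N) :
    Measurable fun x => (A x)⁻¹ i j := by
  have : ∀ x, (A x)⁻¹ i j = (A x).det⁻¹ * (A x).adjugate i j := by
    intro x; rw [Matrix.inv_def, Ring.inverse_eq_inv']; rfl
  simp_rw [this]
  have h1 : Measurable fun x => (A x).det := (hA.matrix_det).measurable
  have h2 : Measurable fun x => (A x).adjugate i j := (hA.matrix_adjugate.matrix_elem i j).measurable
  exact h1.inv.mul h2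

lemma rsv_meas (z : ℂ) (i j : Fin N) : Measurable fun W : PIdx N → ℂ => rsv (wig W) z i j := by
  apply inv_meas
  have : Continuous fun W : PIdx N → ℂ => wig W := continuous_matrix wig_cont
  fun_prop

lemma mrsv_meas (k : Fin N) (z : ℂ) (i j : Fin N) :
    Measurable fun W : PIdx N → ℂ => mrsv k (wig W) z i j := by
  simp only [mrsv]
  split_ifs
  · fun_prop
  · apply inv_meas
    have : Continuous fun W : PIdx N → ℂ => zrow k (wig W) := by
      refine continuous_matrix fun a b => ?_
      simp only [zrow]
      split_ifs
      · fun_prop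
      · exact wig_cont a b
    fun_prop

lemma st_meas (z : ℂ) : Measurable fun W : PIdx N → ℂ => stTrans (wig W) z := by
  have : Measurable fun W : PIdx N → ℂ => (rsv (wig W) z).trace := by
    simp only [Matrix.trace, Matrix.diag]
    exact Finset.measurable_sum _ fun i _ => rsv_meas z i i
  exact this.div_const _

lemma eps_meas (k : Fin N) (z : ℂ) : Measurable fun W : PIdx N → ℂ => eps k (wig W) z := by
  unfold eps
  exact ((rsv_meas z k k).inv.add_const z).add (st_meas z)

lemma pcol_inj (k : Fin N) : Function.Injective (pcol k) := by
  intro i j h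
  simp only [pcol, Subtype.mk.injEq, Prod.mk.injEq] at h
  obtain ⟨h1, h2⟩ := h
  rcases le_total i k with a | a <;> rcases le_total j k with b | b <;> simp_all <;> order

lemma fcol_meas (k j : Fin N) : Measurable (fcol k j) := by
  unfold fcol; split_ifs
  · fun_prop
  · exact Complex.continuous_conj.measurable

lemma wig_col (W : PIdx N → ℂ) (k j : Fin N) (h : j ≠ k) :
    wig W j k = fcol k j (W (pcol k j)) / (√(N : ℝ) : ℂ) := by
  rcases lt_or_gt_of_ne h with h | h
  · simp [wig, fcol, pcol, h, min_eq_left h.le, max_eq_right h.le]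
  · simp [wig, fcol, pcol, h, h.not_gt, min_eq_right h.le, max_eq_left h.le]

lemma mrsv_upd (k : Fin N) (z : ℂ) (l : Fin N) (W : PIdx N → ℂ) (y : ℂ) :
    mrsv k (wig (Function.update W (pcol k l) y)) z = mrsv k (wig W) z := by
  have hne : ∀ i j (h : i ≤ j), i ≠ k → j ≠ k → (⟨(i, j), h⟩ : PIdx N) ≠ pcol k l := by
    intro i j h hi hj he
    simp only [pcol, Subtype.mk.injEq, Prod.mk.injEq] at he
    rcases le_total l k with a | a
    · rw [max_eq_right a] at he; exact hj he.2
    · rw [min_eq_right a] at he; exact hi he.1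
  have : zrow k (wig (Function.update W (pcol k l) y)) = zrow k (wig W) := by
    funext i j
    simp only [zrow]
    split_ifs with h
    · rfl
    · push Not at h
      simp only [wig]
      split_ifs with h1 h2
      · rw [Function.update_of_ne (hne _ _ _ h.1 h.2)]
      · rw [Function.update_of_ne (hne _ _ _ h.2 h.1)]
      · rw [Function.update_of_ne (hne _ _ _ h.1 h.1)]
  funext i j
  simp only [mrsv, this]

lemma eps_bound (hN : 0 < N) (W : PIdx N → ℂ) (k : Fin N) {z : ℂ} (hz : 0 < z.im) :
    ‖eps k (wig W) z‖ ≤ |(W (pcol k k)).re| / √(N : ℝ) +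
      ‖∑ i, ∑ j, conj (fcol k i (W (pcol k i))) * mrsv k (wig W) z i j * fcol k j (W (pcol k j))
        - ∑ i, mrsv k (wig W) z i i‖ / N + 1 / (N * z.im) := by
  obtain ⟨h1, h2⟩ := schur (wig_herm W) k hz
  have hNr : (0 : ℝ) < N := by exact_mod_cast hN
  have hNc : (N : ℂ) ≠ 0 := by exact_mod_cast hN.ne'
  have hsq : (√(N : ℝ) : ℂ) * (√(N : ℝ) : ℂ) = N := by
    rw [← Complex.ofReal_mul, Real.mul_self_sqrt hNr.le]; simp
  have hs0 : (√(N : ℝ) : ℂ) ≠ 0 := by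
    intro h; rw [h] at hsq; simp at hsq; exact hNc hsq.symm
  set S := mrsv k (wig W) z with hS
  have hq : star (zcol k (wig W)) ⬝ᵥ (S *ᵥ zcol k (wig W)) =
      (∑ i, ∑ j, conj (fcol k i (W (pcol k i))) * S i j * fcol k j (W (pcol k j))) / N := by
    rw [dotProduct, Finset.sum_div]
    refine Finset.sum_congr rfl fun i _ => ?_
    rw [Matrix.mulVec, dotProduct, Finset.mul_sum, Finset.sum_div]
    refine Finset.sum_congr rfl fun j _ => ?_
    by_cases hi : i = k
    · simp [hS, mrsv, hi]
    · by_cases hj : j = k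
      · simp [hS, mrsv, hj]
      · simp only [Pi.star_apply, zcol, hi, hj, if_false]
        rw [wig_col W k i hi, wig_col W k j hj, ← hsq]
        simp only [RCLike.star_def, map_div₀, Complex.conj_ofReal]
        field_simp
  have hkk : wig W k k = ((W (pcol k k)).re : ℂ) / (√(N : ℝ) : ℂ) := by
    simp [wig, pcol]
  have he : eps k (wig W) z = ((W (pcol k k)).re : ℂ) / (√(N : ℝ) : ℂ) -
      (∑ i, ∑ j, conj (fcol k i (W (pcol k i))) * S i j * fcol k j (W (pcol k j)) - ∑ i, S i i) / N +
      ((rsv (wig W) z).trace - S.trace) / N := by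
    rw [eps, h1, hq, hkk]
    simp only [stTrans, rsv, Matrix.trace, Matrix.diag]
    ring
  rw [he]
  refine (norm_add_le _ _).trans (add_le_add ((norm_sub_le _ _).trans (add_le_add ?_ ?_)) ?_)
  · rw [norm_div, Complex.norm_real, Complex.norm_real, Real.norm_eq_abs, Real.norm_eq_abs,
      abs_of_nonneg (Real.sqrt_nonneg _)]
  · rw [norm_div]; simp
  · rw [norm_div]
    simp only [Complex.norm_natCast]
    calc _ ≤ (1 / z.im) / N := by gcongr
      _ = _ := by field_simp
end


/-- hypotheses on the laws of the rescaled entries -/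
structure GoodLaw {N : ℕ} (ρ : PIdx N → Measure ℂ) (C g₀ δ₀ D' : ℝ) : Prop where
  prob : ∀ p, IsProbabilityMeasure (ρ p)
  sg : ∀ p : PIdx N, p.1.1 < p.1.2 →
    SG (ρ p) (fun y => y) C g₀ ∧ SG (ρ p) (fun y => conj y) C g₀
  dg : ∀ k, ∫⁻ y, ee (δ₀ * y.re ^ 2) ∂(ρ (pcol k k)) ≤ ENNReal.ofReal D'

lemma quad_smul {N : ℕ} (τ : ℝ) (S : Matrix (Fin N) (Fin N) ℂ) (v : Fin N → ℂ) :
    ‖∑ i, ∑ j, conj (v i) * ((τ : ℂ) • S) i j * v j - ∑ i, ((τ : ℂ) • S) i i‖ =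
    |τ| * ‖∑ i, ∑ j, conj (v i) * S i j * v j - ∑ i, S i i‖ := by
  rw [← Real.norm_eq_abs, ← Complex.norm_real, ← norm_mul]
  congr 1
  simp only [Matrix.smul_apply, smul_eq_mul, mul_sub, Finset.mul_sum]
  congr 1
  refine Finset.sum_congr rfl fun i _ => Finset.sum_congr rfl fun j _ => ?_
  ring

/-- exponential moment bound of the error terms -/
lemma eps_exp {N : ℕ} (hN : 0 < N) {ρ : PIdx N → Measure ℂ} {C g₀ δ₀ D' : ℝ}
    (hρ : GoodLaw ρ C g₀ δ₀ D') (hC : 1 ≤ C) (hg : 0 < g₀) (hδ : 0 < δ₀)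
    {c : ℝ} (hc0 : 0 < c) (hcg : c ≤ g₀) (hcC : C * c ≤ 1 / 2)
    {E η : ℝ} (hη : 0 < η) (hη2 : η ≤ 2) (hM : 1 ≤ N * η) (k : Fin N) :
    ∫⁻ W, (if (stTrans (wig W) (E + η * Complex.I)).im ≤ 4 then
        ee (c / 20 * √(N * η) * ‖eps k (wig W) (E + η * Complex.I)‖) else 0) ∂(Measure.pi ρ) ≤
      ee (c / 20) * (ee (9 * (c / 20) ^ 2 / (4 * δ₀)) * ENNReal.ofReal D' + 4 * (1 + 3 * ee 1)) := by
  have hprob := hρ.prob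
  set z : ℂ := E + η * Complex.I with hzdef
  have hzim : z.im = η := by simp [hzdef]
  have hz : 0 < z.im := by rw [hzim]; exact hη
  have hNr : (0 : ℝ) < N := by exact_mod_cast hN
  have hNr1 : (1 : ℝ) ≤ N := by exact_mod_cast hN
  set q := √(η / N) with hq
  have hq0 : 0 < q := Real.sqrt_pos.2 (by positivity)
  have hq2 : q ^ 2 = η / N := Real.sq_sqrt (by positivity)
  have hMq : √(N * η) = N * q := by
    rw [show (N : ℝ) * η = (N * q) ^ 2 by rw [mul_pow, hq2]; field_simp]
    exact Real.sqrt_sq (by positivity)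
  set τ : ℝ := 2 / 5 * c * q with hτ
  have hτ0 : 0 ≤ τ := by positivity
  set F : (PIdx N → ℂ) → ℝ := fun W => ∑ i, ∑ j, ‖mrsv k (wig W) z i j‖ ^ 2 with hF
  have hFm : Measurable F := Finset.measurable_sum _ fun i _ => Finset.measurable_sum _ fun j _ =>
    ((mrsv_meas k z i j).norm.pow_const 2)
  have hset : MeasurableSet {W | F W ≤ 5 * N / η} := measurableSet_le hFm measurable_const
  classical
  set T : (PIdx N → ℂ) → Matrix (Fin N) (Fin N) ℂ := fun W =>
    if F W ≤ 5 * N / η then (τ : ℂ) • mrsv k (wig W) z else 0 with hT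
  have hTm : ∀ i j, Measurable fun W => T W i j := by
    intro i j
    have : (fun W => T W i j) = fun W => if F W ≤ 5 * N / η then (τ : ℂ) * mrsv k (wig W) z i j else 0 := by
      funext W; simp only [hT]; split_ifs <;> simp
    rw [this]
    exact Measurable.ite hset ((mrsv_meas k z i j).const_mul _) measurable_const
  have hSG : ∀ j, j ≠ k → SG (ρ (pcol k j)) (fcol k j) C g₀ := by
    intro j hj
    have := hρ.sg (pcol k j) (by simpa [pcol, eq_comm] using hj)
    unfold fcol; split_ifs
    · exact this.1
    · exact this.2
  have hw := hw_norm (ρ := ρ) (k := k) (pcol_inj k) (fcol_meas k) hSG hg.le hC T hTm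
    (fun l W y => by simp only [hT, hF, mrsv_upd])
    (fun W i => by simp only [hT]; split_ifs <;> simp [mrsv])
    (c := c) (fun W => by
      by_cases h : F W ≤ 5 * N / η
      · simp only [hT, if_pos h, Matrix.smul_apply, smul_eq_mul, norm_mul, mul_pow,
          Complex.norm_real, Real.norm_eq_abs, sq_abs, ← Finset.mul_sum]
        calc τ ^ 2 * F W ≤ τ ^ 2 * (5 * N / η) := by gcongr
          _ = 20 / 25 * c ^ 2 := by rw [hτ, mul_pow, hq2]; field_simp; ring
          _ ≤ c ^ 2 := by nlinarith [sq_nonneg c]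
      · simp only [hT, if_neg h]
        simp; positivity) hcC hc0.le hcg
  set Q : (PIdx N → ℂ) → ℝ := fun W => ‖∑ i, ∑ j, conj (fcol k i (W (pcol k i))) *
    T W i j * fcol k j (W (pcol k j)) - ∑ i, T W i i‖ with hQ
  have hd : ∫⁻ W, ee (3 * (c / 20) * |(W (pcol k k)).re|) ∂(Measure.pi ρ) ≤
      ee (9 * (c / 20) ^ 2 / (4 * δ₀)) * ENNReal.ofReal D' := by
    have hmp := measurePreserving_eval ρ (pcol k k)
    have hm : Measurable fun y : ℂ => ee (3 * (c / 20) * |y.re|) := by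
      apply Measurable.ee; exact (Complex.measurable_re.abs).const_mul _
    rw [hmp.lintegral_comp (f := fun y : ℂ => ee (3 * (c / 20) * |y.re|)) hm]
    calc _ ≤ ∫⁻ y, ee (9 * (c / 20) ^ 2 / (4 * δ₀)) * ee (δ₀ * y.re ^ 2) ∂(ρ (pcol k k)) := by
          refine lintegral_mono fun y => ?_
          simp only
          rw [← ee_add]
          apply ee_mono
          rw [← sq_abs y.re]
          set x := |y.re|
          have : 0 ≤ (2 * δ₀ * x - 3 * (c / 20)) ^ 2 / (4 * δ₀) := by positivity
          have e : (2 * δ₀ * x - 3 * (c / 20)) ^ 2 / (4 * δ₀) =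
            9 * (c / 20) ^ 2 / (4 * δ₀) + δ₀ * x ^ 2 - 3 * (c / 20) * x := by field_simp; ring
          linarith
      _ ≤ _ := by
          rw [lintegral_const_mul _ (by fun_prop)]
          gcongr
          exact hρ.dg k
  calc _ ≤ ∫⁻ W, ee (c / 20) * (ee (3 * (c / 20) * |(W (pcol k k)).re|) + ee (Q W / 4)) ∂(Measure.pi ρ) := by
        refine lintegral_mono fun W => ?_
        simp only
        split_ifs with him
        swap
        · exact zero_le
        have hFle : F W ≤ 5 * N / η := by
          have h1 := mrsv_sq_le (wig_herm W) k hz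
          have h2 := (schur (wig_herm W) k hz).2
          rw [hzim] at h1 h2
          have h3 : (stTrans (wig W) z).im = (rsv (wig W) z).trace.im / N := by
            rw [stTrans, rsv, ← Complex.ofReal_natCast, Complex.div_ofReal_im]
          have h4 := (Complex.abs_im_le_norm _).trans h2
          rw [Complex.sub_im, abs_le] at h4
          rw [h3, div_le_iff₀ hNr] at him
          have h5 : 1 / η ≤ N := by rw [div_le_iff₀ hη]; exact hM
          rw [le_div_iff₀ hη]
          have : η * F W = (mrsv k (wig W) z).trace.im := h1
          linarith [h4.1]
        have hb := eps_bound hN W k hz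
        have hQe : Q W = τ * ‖∑ i, ∑ j, conj (fcol k i (W (pcol k i))) * mrsv k (wig W) z i j * fcol k j (W (pcol k j))
            - ∑ i, mrsv k (wig W) z i i‖ := by
          simp only [hQ, hT, if_pos hFle]
          rw [quad_smul τ (mrsv k (wig W) z) (fun i => fcol k i (W (pcol k i))), abs_of_nonneg hτ0]
        set Y := ‖∑ i, ∑ j, conj (fcol k i (W (pcol k i))) * mrsv k (wig W) z i j * fcol k j (W (pcol k j))
            - ∑ i, mrsv k (wig W) z i i‖ with hY
        set x := |(W (pcol k k)).re| with hx
        have hx0 : 0 ≤ x := abs_nonneg _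
        refine le_trans (ee_mono (y := c / 20 + (3 * (c / 20) * x + Q W / 4) / 2) ?_) ?_
        · rw [hQe, hMq]
          calc c / 20 * (N * q) * ‖eps k (wig W) z‖ ≤ c / 20 * (N * q) * (x / √N + Y / N + 1 / (N * z.im)) := by
                gcongr
            _ = c / 20 * (N * q / √N) * x + c / 20 * q * Y + c / 20 * (q / η) := by
                rw [hzim]; field_simp
            _ ≤ c / 20 * (3 / 2) * x + c / 20 * q * Y + c / 20 * 1 := by
                have h1 : N * q / √N ≤ 3 / 2 := by
                  rw [← hMq, Real.sqrt_mul hNr.le, mul_div_assoc, mul_comm, div_mul_cancel₀ _ (Real.sqrt_pos.2 hNr).ne']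
                  rw [Real.sqrt_le_left (by norm_num)]; linarith
                have h2 : q / η ≤ 1 := by
                  rw [div_le_one hη, hq, Real.sqrt_le_left hη.le, div_le_iff₀ hNr]
                  nlinarith
                exact add_le_add (add_le_add (by gcongr) le_rfl) (by gcongr)
            _ = _ := by rw [hτ]; ring
        · rw [ee_add]
          gcongr
          exact ee_half _ _
    _ ≤ _ := by
        rw [lintegral_const_mul']
        swap
        · exact ee_ne_top _
        rw [lintegral_add_left]
        · gcongr
        · apply Measurable.ee
          exact ((Complex.measurable_re.comp (measurable_pi_apply _)).abs).const_mul _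


lemma seq_lemma (J : ℕ) : ∀ (g : ℕ → ℝ) (bad : ℕ → ℝ) (B : ℝ), 1 ≤ B → (∀ l, 0 ≤ g l) →
    (∀ l, 0 ≤ bad l) → (∀ l, g l ≤ 2 * g (l + 1)) → g J ≤ 1 →
    (∀ l < J, bad l = 1 ∨ g l ≤ B) →
    g 0 ^ 2 ≤ B ^ 2 * (1 + ∑ l ∈ Finset.range J, 4 ^ (l + 1) * bad l) := by
  induction J with
  | zero =>
    intro g bad B hB h0 _ _ h1 _
    have := h0 0
    simp; nlinarith
  | succ J ih =>
    intro g bad B hB h0 hb hd h1 hbad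
    have ih' := ih (fun l => g (l + 1)) (fun l => bad (l + 1)) B hB (fun l => h0 _) (fun l => hb _)
      (fun l => hd _) h1 (fun l hl => hbad _ (by omega))
    simp only [zero_add] at ih'
    rw [Finset.sum_range_succ']
    have hS : 0 ≤ ∑ l ∈ Finset.range J, (4 : ℝ) ^ (l + 1) * bad (l + 1) :=
      Finset.sum_nonneg fun l _ => mul_nonneg (by positivity) (hb _)
    have e : ∑ l ∈ Finset.range J, (4 : ℝ) ^ (l + 1 + 1) * bad (l + 1) =
        4 * ∑ l ∈ Finset.range J, (4 : ℝ) ^ (l + 1) * bad (l + 1) := by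
      rw [Finset.mul_sum]; refine Finset.sum_congr rfl fun l _ => by ring
    rw [e]
    set S := ∑ l ∈ Finset.range J, (4 : ℝ) ^ (l + 1) * bad (l + 1)
    rcases hbad 0 (by omega) with h | h
    · rw [h]
      have h2 : g 0 ^ 2 ≤ (2 * g 1) ^ 2 := pow_le_pow_left₀ (h0 0) (hd 0) 2
      calc g 0 ^ 2 ≤ (2 * g 1) ^ 2 := h2
        _ = 4 * g 1 ^ 2 := by ring
        _ ≤ 4 * (B ^ 2 * (1 + S)) := by gcongr
        _ ≤ B ^ 2 * (1 + (4 * S + 4 ^ (0 + 1) * 1)) := by norm_num; nlinarith [sq_nonneg B]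
    · have hb0 := hb 0
      calc g 0 ^ 2 ≤ B ^ 2 * 1 := by rw [mul_one]; exact pow_le_pow_left₀ (h0 0) h 2
        _ ≤ _ := by gcongr; have : 0 ≤ 4 ^ (0+1) * bad 0 := by positivity
                    linarith

/-- averaging lemma -/
lemma avg_lemma {N : ℕ} (hN : 0 < N) (g e b β : Fin N → ℝ) {B s δ lam τ : ℝ} (hB : 0 < B)
    (he : ∀ k, 0 ≤ e k) (hs : 0 < s) (hδ : 0 < δ) (hlam : 0 < lam)
    (hg : ∀ k, g k ^ 2 ≤ B ^ 2 * (1 + b k)) (hbβ : ∀ k, b k ≤ β k) (hβ : ∀ k, 0 ≤ β k)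
    (hr : s * δ * N ≤ ∑ k, e k * g k) (hτ : τ = lam * (s * δ / (2 * B))) (hτ1 : 1 ≤ τ) :
    (N : ℝ) ≤ ∑ k, (β k + 43 * Real.exp (-(3 * τ / 8)) * Real.exp (lam * e k)) := by
  have hNr : (0 : ℝ) < N := by exact_mod_cast hN
  rw [Finset.sum_add_distrib, ← Finset.mul_sum]
  have hpos : 0 ≤ 43 * Real.exp (-(3 * τ / 8)) * ∑ k, Real.exp (lam * e k) := by positivity
  by_cases hb : (N : ℝ) ≤ ∑ k, β k
  · linarith
  push Not at hb
  have hg2 : ∑ k, g k ^ 2 ≤ 2 * B ^ 2 * N := by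
    calc ∑ k, g k ^ 2 ≤ ∑ k, B ^ 2 * (1 + β k) := by
          refine Finset.sum_le_sum fun k _ => (hg k).trans ?_
          have := hbβ k; gcongr
      _ = B ^ 2 * (N + ∑ k, β k) := by rw [← Finset.mul_sum, Finset.sum_add_distrib]; simp
      _ ≤ B ^ 2 * (N + N) := by gcongr
      _ = _ := by ring
  have hcs : (∑ k, e k * g k) ^ 2 ≤ (∑ k, e k ^ 2) * ∑ k, g k ^ 2 := Finset.sum_mul_sq_le_sq_mul_sq _ _ _
  have he2 : (s * δ / (2 * B)) ^ 2 * N ≤ ∑ k, e k ^ 2 := by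
    have h1 : (s * δ * N) ^ 2 ≤ (∑ k, e k ^ 2) * (2 * B ^ 2 * N) :=
      (pow_le_pow_left₀ (by positivity) hr 2).trans (hcs.trans (by gcongr))
    have h3 : (s * δ * N) ^ 2 = (s * δ / (2 * B)) ^ 2 * N * (4 * B ^ 2 * N) := by field_simp; ring
    have h4 : 0 ≤ ∑ k, e k ^ 2 := Finset.sum_nonneg fun k _ => sq_nonneg _
    have h5 : (s * δ / (2 * B)) ^ 2 * N * (4 * B ^ 2 * N) ≤ (∑ k, e k ^ 2) * (4 * B ^ 2 * N) := by
      rw [← h3]; refine h1.trans ?_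
      gcongr; norm_num
    exact le_of_mul_le_mul_right h5 (by positivity)
  have hu : ∀ k, (lam * e k) ^ 2 ≤ τ ^ 2 / 4 + 32 * (Real.exp (-(3 * τ / 8)) * Real.exp (lam * e k)) := by
    intro k
    rw [← Real.exp_add]
    set u := lam * e k with hu
    have hu0 : 0 ≤ u := mul_nonneg hlam.le (he k)
    rcases le_or_gt u (τ / 2) with h | h
    · have := Real.exp_pos (-(3 * τ / 8) + u)
      nlinarith
    · have h1 : Real.exp (u / 4) ≤ Real.exp (-(3 * τ / 8) + u) := Real.exp_le_exp.2 (by linarith)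
      have h2 := Real.quadratic_le_exp_of_nonneg (x := u / 4) (by positivity)
      nlinarith
  have hsum := Finset.sum_le_sum (s := Finset.univ) fun k _ => hu k
  simp only [mul_pow, ← Finset.mul_sum, Finset.sum_add_distrib] at hsum
  simp at hsum
  have h6 : τ ^ 2 * N ≤ lam ^ 2 * ∑ k, e k ^ 2 := by
    rw [hτ, mul_pow, mul_assoc]; gcongr
  have hτ2 : 1 ≤ τ ^ 2 := by nlinarith
  have hβ0 : 0 ≤ ∑ k, β k := Finset.sum_nonneg fun k _ => hβ k
  have h7 : (N : ℝ) * 1 ≤ N * τ ^ 2 := by gcongr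
  rw [mul_assoc]
  set X := Real.exp (-(3 * τ / 8)) * ∑ k, Real.exp (lam * e k)
  linarith


/-- spectral parameter -/
abbrev zz (E η : ℝ) : ℂ := (E : ℂ) + (η : ℂ) * Complex.I

/-- deviation from the semicircle law -/
def dv {N : ℕ} (A : Matrix (Fin N) (Fin N) ℂ) (E η : ℝ) : ℝ :=
  ‖stTrans A (zz E η) - mSC (zz E η)‖

section
variable {N : ℕ} {A : Matrix (Fin N) (Fin N) ℂ}

lemma zz_im (E η : ℝ) : (zz E η).im = η := by simp

lemma st_im (z : ℂ) : (stTrans A z).im = (rsv A z).trace.im / N := by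
  rw [stTrans, rsv, ← Complex.ofReal_natCast, Complex.div_ofReal_im]

lemma st_im_nonneg (hA : A.IsHermitian) {z : ℂ} (hz : 0 < z.im) : 0 ≤ (stTrans A z).im := by
  rw [st_im]; exact div_nonneg (trace_im_nonneg hA hz) (Nat.cast_nonneg _)

lemma rsv_ne (hA : A.IsHermitian) {z : ℂ} (hz : 0 < z.im) (k : Fin N) : rsv A z k k ≠ 0 := by
  intro h
  have h1 := ward hA hz k
  rw [h, Complex.zero_im] at h1
  have h2 : ∑ j, ‖rsv A z k j‖ ^ 2 = 0 := by
    rcases mul_eq_zero.1 h1.symm with h | h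
    · exact absurd h hz.ne'
    · exact h
  rw [Finset.sum_eq_zero_iff_of_nonneg (fun _ _ => by positivity)] at h2
  have h3 := congrFun (congrFun (rsv_mul hA hz).2 k) k
  rw [Matrix.mul_apply, Matrix.one_apply_eq] at h3
  rw [Finset.sum_eq_zero] at h3
  · exact zero_ne_one h3
  · intro j hj
    have := h2 j hj
    rw [pow_eq_zero_iff two_ne_zero, norm_eq_zero] at this
    rw [this, zero_mul]

lemma st_norm_le (hN : 0 < N) (hA : A.IsHermitian) {z : ℂ} (hz : 0 < z.im) : ‖stTrans A z‖ ≤ 1 / z.im := by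
  have hNr : (0 : ℝ) < N := by exact_mod_cast hN
  have : ‖(rsv A z).trace‖ ≤ N * (1 / z.im) := by
    rw [Matrix.trace]
    refine (norm_sum_le _ _).trans ?_
    refine (Finset.sum_le_sum fun k _ => rsv_diag_le hA hz k).trans ?_
    simp
  rw [stTrans, norm_div, Complex.norm_natCast, div_le_iff₀ hNr, mul_comm]
  exact this

/-- self-consistent equation and stability -/
lemma stab (hN : 0 < N) (hA : A.IsHermitian) {z : ℂ} (hz : 0 < z.im) {s : ℝ} (hs : s ≤ (mSC z).im) :
    s * ‖stTrans A z - mSC z‖ * N ≤ ∑ k, ‖eps k A z‖ * ‖rsv A z k k‖ := by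
  have hNr : (0 : ℝ) < N := by exact_mod_cast hN
  have hNc : (N : ℂ) ≠ 0 := by exact_mod_cast hN.ne'
  set m := stTrans A z with hm
  set w := mSC z with hw
  have hsum : ∑ k, eps k A z * rsv A z k k = N * ((m - w) * (m + z + w)) := by
    have h1 : ∀ k, eps k A z * rsv A z k k = 1 + (z + m) * rsv A z k k := by
      intro k
      have := rsv_ne hA hz k
      rw [eps]; field_simp; ring
    rw [Finset.sum_congr rfl fun k _ => h1 k, Finset.sum_add_distrib, ← Finset.mul_sum]
    have h2 : ∑ k, rsv A z k k = N * m := by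
      rw [hm, stTrans, mul_div_cancel₀ _ hNc]; rfl
    rw [h2]
    simp only [Finset.sum_const, Finset.card_univ, Fintype.card_fin, nsmul_eq_mul, mul_one]
    have := (msc_props hz).1
    linear_combination (N : ℂ) * this
  have h3 : s ≤ ‖m + z + w‖ := by
    refine le_trans ?_ (Complex.im_le_norm _)
    rw [Complex.add_im, Complex.add_im]
    have := st_im_nonneg hA hz
    rw [← hm] at this; linarith
  calc s * ‖m - w‖ * N ≤ ‖m + z + w‖ * ‖m - w‖ * N := by gcongr
    _ = ‖∑ k, eps k A z * rsv A z k k‖ := by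
        rw [hsum, norm_mul, norm_mul, Complex.norm_natCast]; ring
    _ ≤ _ := by
        refine (norm_sum_le _ _).trans (le_of_eq ?_)
        simp

lemma det_main (hN : 0 < N) (hA : A.IsHermitian) {κ E η : ℝ} (hκ : 0 < κ) (hκ2 : κ ≤ 2)
    (hE : E ∈ Set.Icc (-2 + κ) (2 - κ)) (h0 : 0 < η) {J : ℕ} (hJ1 : 1 ≤ 2 ^ J * η) (hJ2 : 2 ^ J * η ≤ 2)
    {s : ℝ} (hs : s = √(κ / 50)) (hT : ∀ l, 1 ≤ l → l ≤ J → dv A E (2 ^ l * η) ≤ s / 2) :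
    (∀ l, l < J ∨ l = 0 → (stTrans A (zz E (2 ^ l * η))).im ≤ 4) ∧
    ∀ k, ‖rsv A (zz E (2 ^ 0 * η)) k k‖ ^ 2 ≤ (8 / s) ^ 2 * (1 + ∑ l ∈ Finset.range J,
      4 ^ (l + 1) * (if s / 8 < ‖eps k A (zz E (2 ^ l * η))‖ then (1 : ℝ) else 0)) := by
  have hs0 : 0 < s := by rw [hs]; positivity
  have hs1 : s ≤ 1 := by rw [hs, Real.sqrt_le_left (by norm_num)]; linarith
  have hNr : (0 : ℝ) < N := by exact_mod_cast hN
  have hpos : ∀ l : ℕ, 0 < 2 ^ l * η := fun l => by positivity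
  have hz : ∀ l : ℕ, 0 < (zz E (2 ^ l * η)).im := fun l => by rw [zz_im]; exact hpos l
  have hle2 : ∀ l ≤ J, 2 ^ l * η ≤ 2 := fun l hl => by
    refine le_trans ?_ hJ2; gcongr; norm_num
  have hsucc : ∀ l : ℕ, (2 : ℝ) ^ (l + 1) * η = 2 * (2 ^ l * η) := fun l => by ring
  have hIm : ∀ l < J, s / 4 ≤ (stTrans A (zz E (2 ^ l * η))).im ∧ (stTrans A (zz E (2 ^ l * η))).im ≤ 4 := by
    intro l hl
    have h1 := hT (l + 1) (by omega) (by omega)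
    have h2 := msc_lower hκ hE (hpos (l + 1)) (hle2 (l + 1) (by omega))
    have h3 := (msc_props (hz (l + 1))).2.1
    have h4 := (Complex.abs_im_le_norm _).trans h1
    have h5 := Complex.im_le_norm (mSC (zz E (2 ^ (l + 1) * η)))
    rw [← hs] at h2
    rw [Complex.sub_im, abs_le] at h4
    have h6 := trace_scale hA E (2 ^ l * η) (hpos l)
    rw [← hsucc] at h6
    have h7 := st_im (A := A) (zz E (2 ^ l * η))
    have h8 := st_im (A := A) (zz E (2 ^ (l + 1) * η))
    have h9 := div_le_div_of_nonneg_right h6.1 hNr.le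
    have h10 := div_le_div_of_nonneg_right h6.2 hNr.le
    rw [mul_div_assoc] at h9 h10
    rw [← h7, ← h8] at h9 h10
    constructor <;> linarith [h4.1, h4.2]
  refine ⟨?_, fun k => ?_⟩
  · intro l hl
    by_cases h : l < J
    · exact (hIm l h).2
    · have hl0 : l = 0 := by tauto
      have hJ0 : J = 0 := by omega
      subst hl0; subst hJ0
      have h1 := (Complex.im_le_norm _).trans (st_norm_le hN hA (hz 0))
      refine h1.trans ?_
      rw [zz_im]
      refine le_trans ?_ (show (1 : ℝ) ≤ 4 by norm_num)
      rw [div_le_one (hpos 0)]; exact hJ1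
  · refine seq_lemma J (fun l => ‖rsv A (zz E (2 ^ l * η)) k k‖) (fun l => if s / 8 < ‖eps k A (zz E (2 ^ l * η))‖ then (1 : ℝ) else 0)
      (8 / s) ?_ (fun l => norm_nonneg _) (fun l => by positivity) (fun l => ?_) ?_ (fun l hl => ?_)
    · rw [le_div_iff₀ hs0]; linarith
    · have := rsv_scale hA E (2 ^ l * η) (hpos l) k
      simp only [hsucc]; exact this
    · refine (rsv_diag_le hA (hz J) k).trans ?_
      rw [zz_im, div_le_one (hpos J)]; exact hJ1
    · by_cases h : s / 8 < ‖eps k A (zz E (2 ^ l * η))‖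
      · left; simp [h]
      · right
        push Not at h
        have h1 := (hIm l hl).1
        have hne := rsv_ne hA (hz l) k
        set z := zz E (2 ^ l * η)
        set G := rsv A z k k
        have h2 : s / 8 ≤ ‖G⁻¹‖ := by
          have e : z + stTrans A z = eps k A z - G⁻¹ := by rw [eps]; ring
          have h3 : s / 4 ≤ ‖z + stTrans A z‖ := by
            refine le_trans ?_ (Complex.im_le_norm _)
            rw [Complex.add_im]; linarith [hz l]
          rw [e] at h3
          linarith [norm_sub_le (eps k A z) G⁻¹]
        rw [norm_inv] at h2
        have h4 : 0 < ‖G‖ := norm_pos_iff.2 hne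
        show ‖G‖ ≤ 8 / s
        rw [le_div_iff₀ hs0]
        rw [le_inv_comm₀ (by positivity) h4] at h2
        rw [inv_div] at h2
        rwa [le_div_iff₀ hs0] at h2
end


/-- constant of the geometric sum -/
def Cg (α : ℝ) : ℝ := 368640 / α ^ 6

lemma geo_sum {α M : ℝ} (hα : 0 < α) (hM : 1 ≤ M) (J : ℕ) :
    ∑ l ∈ Finset.range J, (4 : ℝ) ^ (l + 1) * Real.exp (-(α * √(2 ^ l * M))) ≤
      Cg α * Real.exp (-(α / 2 * √M)) := by
  have hterm : ∀ l : ℕ, (4 : ℝ) ^ (l + 1) * Real.exp (-(α * √(2 ^ l * M))) ≤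
      (184320 / α ^ 6 * Real.exp (-(α / 2 * √M))) * (1 / 2) ^ l := by
    intro l
    have hx : 1 ≤ √M := by rw [Real.one_le_sqrt]; exact hM
    have hy : 1 ≤ √((2 : ℝ) ^ l) := by rw [Real.one_le_sqrt]; exact one_le_pow₀ (by norm_num)
    rw [Real.sqrt_mul (by positivity)]
    have hy6 : √((2 : ℝ) ^ l) ^ 6 = 8 ^ l := by
      calc √((2 : ℝ) ^ l) ^ 6 = (√((2 : ℝ) ^ l) ^ 2) ^ 3 := by ring
        _ = (2 ^ l) ^ 3 := by rw [Real.sq_sqrt (by positivity)]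
        _ = 8 ^ l := by rw [← pow_mul, mul_comm, pow_mul]; norm_num
    set y := √((2 : ℝ) ^ l)
    set x := √M
    have hxy : (x + y) / 2 ≤ y * x := by nlinarith
    have h1 : Real.exp (-(α * (y * x))) ≤ Real.exp (-(α / 2 * x)) * Real.exp (-(α / 2 * y)) := by
      rw [← Real.exp_add]
      apply Real.exp_le_exp.2
      nlinarith
    have h2 : Real.exp (-(α / 2 * y)) ≤ 46080 / (α ^ 6 * 8 ^ l) := by
      rw [Real.exp_neg, ← hy6]
      have := Real.pow_div_factorial_le_exp (x := α / 2 * y) (by positivity) 6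
      have e : (46080 : ℝ) / (α ^ 6 * y ^ 6) = ((α / 2 * y) ^ 6 / (Nat.factorial 6 : ℕ))⁻¹ := by
        simp only [Nat.factorial]; push_cast; field_simp; norm_num
      rw [e]
      exact inv_anti₀ (by positivity) this
    calc (4 : ℝ) ^ (l + 1) * Real.exp (-(α * (y * x)))
        ≤ 4 ^ (l + 1) * (Real.exp (-(α / 2 * x)) * (46080 / (α ^ 6 * 8 ^ l))) := by
          gcongr; exact h1.trans (by gcongr)
      _ = _ := by
          rw [show (8 : ℝ) ^ l = 4 ^ l * 2 ^ l by rw [← mul_pow]; norm_num, one_div, inv_pow]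
          field_simp; ring
  calc _ ≤ ∑ l ∈ Finset.range J, (184320 / α ^ 6 * Real.exp (-(α / 2 * √M))) * (1 / 2) ^ l :=
        Finset.sum_le_sum fun l _ => hterm l
    _ = (184320 / α ^ 6 * Real.exp (-(α / 2 * √M))) * ∑ l ∈ Finset.range J, (1 / 2 : ℝ) ^ l := by
        rw [Finset.mul_sum]
    _ ≤ (184320 / α ^ 6 * Real.exp (-(α / 2 * √M))) * 2 := by
        gcongr
        exact sum_geometric_two_le J
    _ = _ := by rw [Cg]; ring

lemma Cg_pos {α : ℝ} (hα : 0 < α) : 0 < Cg α := by unfold Cg; positivity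

/-- exponential moment hypothesis -/
def EpsExp {N : ℕ} (π : Measure (PIdx N → ℂ)) (a K : ℝ) : Prop :=
  ∀ (E η : ℝ), 0 < η → η ≤ 2 → 1 ≤ N * η → ∀ k : Fin N,
    ∫⁻ W, (if (stTrans (wig W) (zz E η)).im ≤ 4 then
        ee (a * √(N * η) * ‖eps k (wig W) (zz E η)‖) else 0) ∂π ≤ ENNReal.ofReal K

lemma one_step {N : ℕ} (hN : 0 < N) {π : Measure (PIdx N → ℂ)} [IsProbabilityMeasure π] {a K : ℝ} (ha : 0 < a)
    (hK : 0 ≤ K) (hπ : EpsExp π a K) {κ E η δ : ℝ} (hκ : 0 < κ) (hκ2 : κ ≤ 2)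
    (hE : E ∈ Set.Icc (-2 + κ) (2 - κ)) (h0 : 0 < η) (hM : 1 ≤ N * η) {J : ℕ} (hJ1 : 1 ≤ 2 ^ J * η)
    (hJ2 : 2 ^ J * η ≤ 2) {s : ℝ} (hs : s = √(κ / 50)) (hδ : 0 < δ) (hδ2 : δ ≤ 2) :
    π {W | (∀ l, 1 ≤ l → l ≤ J → dv (wig W) E (2 ^ l * η) ≤ s / 2) ∧ δ ≤ dv (wig W) E η} ≤
      ENNReal.ofReal ((K * (Cg (a * s / 8) + 43) + 3) * Real.exp (-(a * s ^ 2 / 64 * δ * √(N * η)))) := by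
  have hs0 : 0 < s := by rw [hs]; positivity
  have hs1 : s ≤ 1 := by rw [hs, Real.sqrt_le_left (by norm_num)]; linarith
  have hNr : (0 : ℝ) < N := by exact_mod_cast hN
  set M := N * η with hMd
  have hCg := Cg_pos (show 0 < a * s / 8 by positivity)
  have hM0 : 0 < √M := Real.sqrt_pos.2 (by linarith)
  set τ := a * √M * (s * δ / (2 * (8 / s))) with hτ
  have hτe : τ = a * s ^ 2 / 16 * δ * √M := by rw [hτ]; field_simp; ring
  set Ev := {W : PIdx N → ℂ | (∀ l, 1 ≤ l → l ≤ J → dv (wig W) E (2 ^ l * η) ≤ s / 2) ∧ δ ≤ dv (wig W) E η}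
  rcases lt_or_ge τ 1 with hτ1 | hτ1
  · refine prob_le_one.trans ?_
    rw [ENNReal.one_le_ofReal]
    have h1 : Real.exp (-1) ≤ Real.exp (-(a * s ^ 2 / 64 * δ * √M)) := by
      apply Real.exp_le_exp.2
      have : 0 < a * s ^ 2 * δ * √M := by positivity
      rw [hτe] at hτ1; linarith
    have h2 : 1 ≤ 3 * Real.exp (-1) := by
      rw [Real.exp_neg, ← div_eq_mul_inv, le_div_iff₀ (Real.exp_pos _)]
      linarith [Real.exp_one_lt_d9]
    have h3 := Real.exp_pos (-(a * s ^ 2 / 64 * δ * √M))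
    have h4 : 0 ≤ K * (Cg (a * s / 8) + 43) := by positivity
    nlinarith
  -- main case
  set X : ℕ → Fin N → (PIdx N → ℂ) → ℝ≥0∞ := fun l k W =>
    if (stTrans (wig W) (zz E (2 ^ l * η))).im ≤ 4 then
        ee (a * √(N * (2 ^ l * η)) * ‖eps k (wig W) (zz E (2 ^ l * η))‖) else 0 with hX
  have hXm : ∀ l k, Measurable (X l k) := by
    intro l k
    refine Measurable.ite (measurableSet_le (Complex.measurable_im.comp (st_meas _)) measurable_const) ?_ measurable_const
    exact Measurable.ee ((eps_meas k _).norm.const_mul _)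
  have hMl : ∀ l : ℕ, N * (2 ^ l * η) = 2 ^ l * M := fun l => by rw [hMd]; ring
  have hXi : ∀ l ≤ J, ∀ k, ∫⁻ W, X l k W ∂π ≤ ENNReal.ofReal K := by
    intro l hl k
    refine hπ E (2 ^ l * η) (by positivity) ?_ ?_ k
    · refine le_trans ?_ hJ2; gcongr; norm_num
    · rw [hMl]
      have : (1 : ℝ) ≤ 2 ^ l := one_le_pow₀ (by norm_num)
      nlinarith
  set r : ℕ → ℝ := fun l => 4 ^ (l + 1) * Real.exp (-(a * s / 8 * √(2 ^ l * M))) with hr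
  have hr0 : ∀ l, 0 ≤ r l := fun l => by positivity
  set R : ℝ := 43 * Real.exp (-(3 * τ / 8)) with hR
  have hR0 : 0 ≤ R := by positivity
  set Φ : (PIdx N → ℂ) → ℝ≥0∞ := fun W => ∑ k, (∑ l ∈ Finset.range J, ENNReal.ofReal (r l) * X l k W + ENNReal.ofReal R * X 0 k W) with hΦ
  have hΦm : Measurable Φ := by
    refine Finset.measurable_sum _ fun k _ => Measurable.add ?_ ((hXm 0 k).const_mul _)
    exact Finset.measurable_sum _ fun l _ => (hXm l k).const_mul _
  have hΦi : ∫⁻ W, Φ W ∂π ≤ N * ENNReal.ofReal (K * (∑ l ∈ Finset.range J, r l + R)) := by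
    have hk : ∀ k : Fin N, ∫⁻ W, (∑ l ∈ Finset.range J, ENNReal.ofReal (r l) * X l k W + ENNReal.ofReal R * X 0 k W) ∂π ≤
        ENNReal.ofReal (K * (∑ l ∈ Finset.range J, r l + R)) := by
      intro k
      rw [lintegral_add_right _ ((hXm 0 k).const_mul _), lintegral_finsetSum _ (fun l _ => (hXm l k).const_mul _),
        lintegral_const_mul _ (hXm 0 k)]
      rw [mul_comm K, add_mul, ENNReal.ofReal_add (mul_nonneg (Finset.sum_nonneg fun l _ => hr0 l) hK) (by positivity),
        ENNReal.ofReal_mul hR0, Finset.sum_mul, ENNReal.ofReal_sum_of_nonneg (fun l _ => mul_nonneg (hr0 l) hK)]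
      gcongr with l hl
      · rw [lintegral_const_mul _ (hXm l k), ENNReal.ofReal_mul (hr0 l)]
        gcongr
        exact hXi l (Finset.mem_range.1 hl).le k
      · exact hXi 0 (Nat.zero_le _) k
    simp only [hΦ]
    rw [lintegral_finsetSum]
    · refine (Finset.sum_le_sum fun k _ => hk k).trans ?_
      simp
    · intro k _
      refine Measurable.add ?_ ((hXm 0 k).const_mul _)
      exact Finset.measurable_sum _ fun l _ => (hXm l k).const_mul _
  have hpt : Ev ⊆ {W | (N : ℝ≥0∞) ≤ Φ W} := by
    rintro W ⟨hT, hd⟩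
    have hA := wig_herm W
    obtain ⟨him, hG⟩ := det_main hN hA hκ hκ2 hE h0 hJ1 hJ2 hs hT
    have hst := stab hN hA (z := zz E (2 ^ 0 * η)) (s := s) (by rw [zz_im]; simpa using h0)
      (by rw [hs]; refine msc_lower hκ hE (by simpa using h0) ?_
          refine le_trans ?_ hJ2
          gcongr
          · norm_num
          · omega)
    have havg := avg_lemma hN (fun k => ‖rsv (wig W) (zz E (2 ^ 0 * η)) k k‖) (fun k => ‖eps k (wig W) (zz E (2 ^ 0 * η))‖)
      (fun k => ∑ l ∈ Finset.range J, 4 ^ (l + 1) * (if s / 8 < ‖eps k (wig W) (zz E (2 ^ l * η))‖ then (1 : ℝ) else 0))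
      (fun k => ∑ l ∈ Finset.range J, r l * Real.exp (a * √(2 ^ l * M) * ‖eps k (wig W) (zz E (2 ^ l * η))‖))
      (B := 8 / s) (s := s) (δ := δ) (lam := a * √M) (τ := τ) (by positivity) (fun k => norm_nonneg _) hs0 hδ
      (by positivity) hG
      (fun k => by
        refine Finset.sum_le_sum fun l _ => ?_
        simp only [hr]
        rw [mul_assoc]
        gcongr
        rw [← Real.exp_add]
        split_ifs with h
        · rw [Real.one_le_exp_iff]
          have : 0 < a * √(2 ^ l * M) := by
            have : 0 < √(2 ^ l * M) := Real.sqrt_pos.2 (by positivity)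
            positivity
          nlinarith
        · positivity)
      (fun k => Finset.sum_nonneg fun l _ => by have := hr0 l; positivity)
      (by
        refine le_trans ?_ hst
        have : dv (wig W) E η = ‖stTrans (wig W) (zz E (2 ^ 0 * η)) - mSC (zz E (2 ^ 0 * η))‖ := by
          rw [dv, pow_zero, one_mul]
        rw [← this]
        gcongr) hτ hτ1
    have h2 := ENNReal.ofReal_le_ofReal havg
    rw [ENNReal.ofReal_natCast] at h2
    refine h2.trans (le_of_eq ?_)
    rw [ENNReal.ofReal_sum_of_nonneg]
    swap
    · intro k _
      exact add_nonneg (Finset.sum_nonneg fun l _ => by have := hr0 l; positivity) (by positivity)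
    simp only [hΦ]
    refine Finset.sum_congr rfl fun k _ => ?_
    rw [ENNReal.ofReal_add (Finset.sum_nonneg fun l _ => by have := hr0 l; positivity) (by positivity),
      ENNReal.ofReal_sum_of_nonneg (fun l _ => by have := hr0 l; positivity)]
    congr 1
    · refine Finset.sum_congr rfl fun l hl => ?_
      simp only [hX]
      rw [if_pos (him l (Or.inl (Finset.mem_range.1 hl))), ENNReal.ofReal_mul (hr0 l), hMl, ee]
    · simp only [hX]
      rw [if_pos (him 0 (Or.inr rfl)), ENNReal.ofReal_mul hR0, hMl, ee]
      simp only [pow_zero, one_mul]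
  have hN0 : (N : ℝ≥0∞) ≠ 0 := by exact_mod_cast hN.ne'
  have hmk : π Ev ≤ ENNReal.ofReal (K * (∑ l ∈ Finset.range J, r l + R)) := by
    refine (measure_mono hpt).trans ?_
    have h1 := mul_meas_ge_le_lintegral hΦm (N : ℝ≥0∞) (μ := π)
    have h2 := h1.trans hΦi
    exact (ENNReal.mul_le_mul_iff_right hN0 (ENNReal.natCast_ne_top N)).1 h2
  refine hmk.trans (ENNReal.ofReal_le_ofReal ?_)
  have hgs := geo_sum (show 0 < a * s / 8 by positivity) hM J
  have hx : 0 ≤ a * s * √M := by positivity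
  have e1 : Real.exp (-(a * s / 8 / 2 * √M)) ≤ Real.exp (-(a * s ^ 2 / 64 * δ * √M)) := by
    apply Real.exp_le_exp.2
    have h1 : s * δ ≤ 2 := by nlinarith
    nlinarith [mul_le_mul_of_nonneg_left h1 hx]
  have e2 : Real.exp (-(3 * τ / 8)) ≤ Real.exp (-(a * s ^ 2 / 64 * δ * √M)) := by
    apply Real.exp_le_exp.2
    have : 0 < a * s ^ 2 * δ * √M := by positivity
    rw [hτe]; nlinarith
  set X0 := Real.exp (-(a * s ^ 2 / 64 * δ * √M)) with hX0
  have hX0p : 0 < X0 := Real.exp_pos _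
  calc K * (∑ l ∈ Finset.range J, r l + R) ≤ K * (Cg (a * s / 8) * X0 + 43 * X0) := by
        gcongr
        · exact hgs.trans (by gcongr)
        · exact mul_le_mul_of_nonneg_left e2 (by norm_num)
    _ ≤ _ := by nlinarith


lemma tail_ind {N : ℕ} (hN : 0 < N) {π : Measure (PIdx N → ℂ)} [IsProbabilityMeasure π] {a K : ℝ} (ha : 0 < a)
    (hK : 0 ≤ K) (hπ : EpsExp π a K) {κ E : ℝ} (hκ : 0 < κ) (hκ2 : κ ≤ 2)
    (hE : E ∈ Set.Icc (-2 + κ) (2 - κ)) {s C₂ c₂ : ℝ} (hs : s = √(κ / 50))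
    (hC₂ : C₂ = K * (Cg (a * s / 8) + 43) + 3) (hc₂ : c₂ = a * s ^ 2 / 64) (J : ℕ) :
    ∀ η : ℝ, 0 < η → 1 ≤ N * η → 1 ≤ 2 ^ J * η → 2 ^ J * η ≤ 2 →
    π {W | ∃ l ≤ J, s / 2 ≤ dv (wig W) E (2 ^ l * η)} ≤
      ENNReal.ofReal (∑ l ∈ Finset.range (J + 1), C₂ * Real.exp (-(c₂ * (s / 2) * √(2 ^ l * (N * η))))) := by
  have hs0 : 0 < s := by rw [hs]; positivity
  have hs1 : s ≤ 1 := by rw [hs, Real.sqrt_le_left (by norm_num)]; linarith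
  have hCg := Cg_pos (show 0 < a * s / 8 by positivity)
  have hC0 : 0 < C₂ := by rw [hC₂]; positivity
  induction J with
  | zero =>
    intro η h0 hM h1 h2
    have := one_step hN ha hK hπ hκ hκ2 hE h0 hM (J := 0) h1 h2 hs (δ := s / 2) (by positivity) (by linarith)
    rw [← hC₂, ← hc₂] at this
    simp only [zero_add, Finset.sum_range_one, pow_zero, one_mul]
    refine le_trans (measure_mono ?_) this
    rintro W ⟨l, hl, h⟩
    obtain rfl : l = 0 := by omega
    refine ⟨fun l h1 h2 => by omega, by simpa using h⟩
  | succ J ih =>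
    intro η h0 hM h1 h2
    have := one_step hN ha hK hπ hκ hκ2 hE h0 hM (J := J + 1) h1 h2 hs (δ := s / 2) (by positivity) (by linarith)
    rw [← hC₂, ← hc₂] at this
    have ih' := ih (2 * η) (by positivity) (by linarith) (by rw [← mul_assoc, ← pow_succ]; exact h1)
      (by rw [← mul_assoc, ← pow_succ]; exact h2)
    rw [Finset.sum_range_succ', ENNReal.ofReal_add (Finset.sum_nonneg fun l _ => by positivity)
      (by positivity)]
    have e : ∀ l : ℕ, (2 : ℝ) ^ l * (N * (2 * η)) = 2 ^ (l + 1) * (N * η) := fun l => by ring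
    simp only [e] at ih'
    have e2 : ∀ l : ℕ, (2 : ℝ) ^ l * (2 * η) = 2 ^ (l + 1) * η := fun l => by ring
    simp only [e2] at ih'
    simp only [pow_zero, one_mul]
    refine le_trans (measure_mono ?_) (((measure_union_le _ _).trans (add_le_add this ih')).trans (le_of_eq (add_comm _ _)))
    rintro W ⟨l, hl, h⟩
    by_cases hW : ∃ l ≤ J, s / 2 ≤ dv (wig W) E (2 ^ (l + 1) * η)
    · right; exact hW
    · left
      push Not at hW
      constructor
      · intro l' h1 h2
        obtain ⟨l'', rfl⟩ : ∃ l'', l' = l'' + 1 := ⟨l' - 1, by omega⟩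
        exact (hW l'' (by omega)).le
      · rcases Nat.eq_zero_or_pos l with rfl | hl0
        · simpa using h
        · obtain ⟨l'', rfl⟩ : ∃ l'', l = l'' + 1 := ⟨l - 1, by omega⟩
          exact absurd h (not_le.2 (hW l'' (by omega)))

lemma pi_main {N : ℕ} (hN : 0 < N) {π : Measure (PIdx N → ℂ)} [IsProbabilityMeasure π] {a K : ℝ} (ha : 0 < a)
    (hK : 0 ≤ K) (hπ : EpsExp π a K) {κ E : ℝ} (hκ : 0 < κ) (hκ2 : κ ≤ 2)
    (hE : E ∈ Set.Icc (-2 + κ) (2 - κ)) {s C₂ c₂ : ℝ} (hs : s = √(κ / 50))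
    (hC₂ : C₂ = K * (Cg (a * s / 8) + 43) + 3) (hc₂ : c₂ = a * s ^ 2 / 64)
    {η δ : ℝ} (h0 : 0 < η) (hη1 : η ≤ 1) (hM : 1 ≤ N * η) (hδ : 0 < δ) (hδ2 : δ ≤ 2) :
    π {W | δ ≤ dv (wig W) E η} ≤
      ENNReal.ofReal (C₂ * (1 + Cg (c₂ * (s / 2))) * Real.exp (-(c₂ * s / 8 * δ * √(N * η)))) := by
  have hs0 : 0 < s := by rw [hs]; positivity
  have hs1 : s ≤ 1 := by rw [hs, Real.sqrt_le_left (by norm_num)]; linarith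
  have hCg := Cg_pos (show 0 < a * s / 8 by positivity)
  have hC0 : 0 < C₂ := by rw [hC₂]; positivity
  have hc0 : 0 < c₂ := by rw [hc₂]; positivity
  have hCg2 := Cg_pos (show 0 < c₂ * (s / 2) by positivity)
  obtain ⟨J, hJ1, hJ2⟩ : ∃ J : ℕ, 1 ≤ 2 ^ J * η ∧ 2 ^ J * η ≤ 2 := by
    obtain ⟨n, hn1, hn2⟩ := exists_nat_pow_near (x := 1 / η) (y := 2) (by rw [le_div_iff₀ h0]; linarith) (by norm_num)
    refine ⟨n + 1, ?_, ?_⟩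
    · rw [div_lt_iff₀ h0] at hn2; exact hn2.le
    · rw [le_div_iff₀ h0] at hn1; rw [pow_succ]; linarith
  have h1 := one_step hN ha hK hπ hκ hκ2 hE h0 hM hJ1 hJ2 hs hδ hδ2
  have h2 := tail_ind hN ha hK hπ hκ hκ2 hE hs hC₂ hc₂ J η h0 hM hJ1 hJ2
  rw [← hC₂, ← hc₂] at h1
  have hsub : {W : PIdx N → ℂ | δ ≤ dv (wig W) E η} ⊆
      {W | (∀ l, 1 ≤ l → l ≤ J → dv (wig W) E (2 ^ l * η) ≤ s / 2) ∧ δ ≤ dv (wig W) E η} ∪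
      {W | ∃ l ≤ J, s / 2 ≤ dv (wig W) E (2 ^ l * η)} := by
    intro W hW
    by_cases h : ∃ l ≤ J, s / 2 ≤ dv (wig W) E (2 ^ l * η)
    · right; exact h
    · left
      push Not at h
      exact ⟨fun l _ hl => (h l hl).le, hW⟩
  refine ((measure_mono hsub).trans ((measure_union_le _ _).trans (add_le_add h1 h2))).trans ?_
  rw [← ENNReal.ofReal_add (by positivity) (Finset.sum_nonneg fun l _ => by positivity)]
  apply ENNReal.ofReal_le_ofReal
  have hgs := geo_sum (show 0 < c₂ * (s / 2) by positivity) hM (J + 1)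
  have h3 : ∑ l ∈ Finset.range (J + 1), C₂ * Real.exp (-(c₂ * (s / 2) * √(2 ^ l * (N * η)))) ≤
      C₂ * (Cg (c₂ * (s / 2)) * Real.exp (-(c₂ * (s / 2) / 2 * √(N * η)))) := by
    rw [← Finset.mul_sum]
    gcongr
    refine le_trans (Finset.sum_le_sum fun l _ => ?_) hgs
    have : (1 : ℝ) ≤ 4 ^ (l + 1) := one_le_pow₀ (by norm_num)
    have := Real.exp_pos (-(c₂ * (s / 2) * √(2 ^ l * (N * η))))
    nlinarith
  have hy : 0 ≤ c₂ * √(N * η) := by positivity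
  have e1 : Real.exp (-(c₂ * (s / 2) / 2 * √(N * η))) ≤ Real.exp (-(c₂ * s / 8 * δ * √(N * η))) := by
    apply Real.exp_le_exp.2
    have : s * δ ≤ s * 2 := by gcongr
    nlinarith [mul_le_mul_of_nonneg_left this hy]
  have e2 : Real.exp (-(c₂ * δ * √(N * η))) ≤ Real.exp (-(c₂ * s / 8 * δ * √(N * η))) := by
    apply Real.exp_le_exp.2
    have : s * δ ≤ 1 * δ := by gcongr
    nlinarith [mul_le_mul_of_nonneg_left this hy, mul_nonneg hy hδ.le]
  set X0 := Real.exp (-(c₂ * s / 8 * δ * √(N * η)))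
  calc _ ≤ C₂ * X0 + C₂ * (Cg (c₂ * (s / 2)) * X0) := by
        refine add_le_add (by gcongr) (h3.trans (by gcongr))
    _ = _ := by ring


lemma aem_of_map {Ω β : Type} [MeasurableSpace Ω] [MeasurableSpace β] {P : Measure Ω} {f : Ω → β} {ν : Measure β}
    [IsProbabilityMeasure ν] (h : P.map f = ν) : AEMeasurable f P := by
  by_contra hc
  rw [Measure.map_of_not_aemeasurable hc] at h
  exact IsProbabilityMeasure.ne_zero ν h.symm

/-- rescaled entries -/
def resc {N : ℕ} (A : Matrix (Fin N) (Fin N) ℂ) : PIdx N → ℂ := fun p => (√(N : ℝ) : ℂ) * A p.1.1 p.1.2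

lemma wig_resc {N : ℕ} (hN : 0 < N) {A : Matrix (Fin N) (Fin N) ℂ} (hA : A.IsHermitian) : wig (resc A) = A := by
  have hNr : (0 : ℝ) < N := by exact_mod_cast hN
  have h0 : (√(N : ℝ) : ℂ) ≠ 0 := by
    rw [Ne, Complex.ofReal_eq_zero]; exact (Real.sqrt_pos.2 hNr).ne'
  ext i j
  simp only [wig, resc]
  split_ifs with h1 h2
  · rw [mul_div_cancel_left₀ _ h0]
  · rw [map_mul, Complex.conj_ofReal, mul_div_cancel_left₀ _ h0]
    exact hA.apply i j
  · obtain rfl : i = j := by order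
    have h3 := hA.coe_re_apply_self i
    rw [Complex.re_ofReal_mul, Complex.ofReal_mul, mul_div_cancel_left₀ _ h0]
    exact h3

lemma reduction {Ω : Type} [MeasurableSpace Ω] {P : Measure Ω} {N : ℕ} (hN : 0 < N)
    {H : Ω → Matrix (Fin N) (Fin N) ℂ} {ν : Measure ℂ} {ν' : Measure ℝ} {δ₀ D D' : ℝ}
    (hW : IsWignerMatrix P N H ν ν') (hC : CondC1 ν ν' δ₀ D D') :
    ∃ ρ : PIdx N → Measure ℂ, GoodLaw ρ (CSG δ₀ D) (δ₀ / 8) δ₀ D' ∧ 1 ≤ D ∧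
      P.map (fun ω => resc (H ω)) = Measure.pi ρ ∧ AEMeasurable (fun ω => resc (H ω)) P := by
  have := hW.prob
  have := hW.probν
  have := hW.probν'
  obtain ⟨hδ, hν, hν'⟩ := hC
  have hdm : ∀ k, AEMeasurable (fun ω => √N * (H ω k k).re) P := fun k => aem_of_map (hW.diag k)
  have hdeq : ∀ k, (fun ω => (√(N : ℝ) : ℂ) * H ω k k) = fun ω => ((√N * (H ω k k).re : ℝ) : ℂ) := by
    intro k; funext ω
    have := hW.diag_real ω k
    apply Complex.ext
    · simp
    · simp [this]
  have haem : ∀ p : PIdx N, AEMeasurable (fun ω => resc (H ω) p) P := by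
    rintro ⟨⟨i, j⟩, hp⟩
    rcases lt_or_eq_of_le hp with h | h
    · exact aem_of_map (hW.offdiag i j h)
    · simp only at h; subst h
      show AEMeasurable (fun ω => (√(N : ℝ) : ℂ) * H ω i i) P
      rw [hdeq]
      exact Complex.measurable_ofReal.comp_aemeasurable (hdm i)
  have hind : iIndepFun (fun (p : PIdx N) ω => resc (H ω) p) P :=
    hW.indep.comp (fun _ y => (√(N : ℝ) : ℂ) * y) (fun _ => by fun_prop)
  refine ⟨fun p => P.map (fun ω => resc (H ω) p), ⟨fun p => Measure.isProbabilityMeasure_map (haem p), ?_, ?_⟩,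
    (site_D hδ hν).2, (iIndepFun_iff_map_fun_eq_pi_map haem).1 hind, aemeasurable_pi_lambda _ haem⟩
  · rintro ⟨⟨i, j⟩, hp⟩ h
    have e : P.map (fun ω => resc (H ω) ⟨(i, j), hp⟩) = ν := hW.offdiag i j h
    rw [e]
    exact ⟨site_SG hδ hW.mean hW.var hν, site_SG_conj hδ hW.mean hW.var hν⟩
  · intro k
    have e1 : (fun ω => resc (H ω) (pcol k k)) = fun ω => ((√N * (H ω k k).re : ℝ) : ℂ) := by
      rw [← hdeq]; funext ω; simp [resc, pcol]
    rw [e1]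
    have hm : Measurable fun y : ℂ => ee (δ₀ * y.re ^ 2) := by
      apply Measurable.ee; exact (Complex.measurable_re.pow_const 2).const_mul _
    have hk : AEMeasurable (fun ω => ((√N * (H ω k k).re : ℝ) : ℂ)) P :=
      Complex.measurable_ofReal.comp_aemeasurable (hdm k)
    rw [lintegral_map' hm.aemeasurable hk]
    rw [← hW.diag k, lintegral_map' (by fun_prop) (hdm k)] at hν'
    simpa only [Complex.ofReal_re, ee] using hν'

lemma CSG_ge {δ₀ D : ℝ} (hδ : 0 < δ₀) (hD : 1 ≤ D) : 1 ≤ CSG δ₀ D := by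
  have : 0 ≤ (16 * D + 4) / δ₀ + 128 * Real.exp (δ₀ / 2) / δ₀ ^ 2 * D := by positivity
  unfold CSG; linarith

lemma rho_ge {κ E : ℝ} (hκ : 0 < κ) (hE : E ∈ Set.Icc (-2 + κ) (2 - κ)) :
    1 ≤ 300 / (Real.pi * rhoSC E) := by
  have h1 := hE.1
  have h2 := hE.2
  have habs : |E| ≤ 2 := abs_le.2 ⟨by linarith, by linarith⟩
  have hp := Real.pi_pos
  have e : Real.pi * rhoSC E = √(4 - E ^ 2) / 2 := by
    rw [rhoSC, if_pos habs]; field_simp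
  rw [e]
  have h3 : 0 < 4 - E ^ 2 := by nlinarith
  have h4 : 0 < √(4 - E ^ 2) := Real.sqrt_pos.2 h3
  have h5 : √(4 - E ^ 2) ≤ 2 := by rw [Real.sqrt_le_left (by norm_num)]; nlinarith [sq_nonneg E]
  rw [le_div_iff₀ (by positivity)]; linarith

/-- **Local semicircle law on the optimal scale.** For a hermitian Wigner matrix satisfying
C1, for `E ∈ [-2+κ, 2-κ]`, `δ ≤ c₁ κ`, `N ≥ 2` and `K/N ≤ η ≤ 1` with `K = 300/(π ρ_sc(E))`,
`P(|m(E+iη) - m_sc(E+iη)| ≥ δ) ≤ C e^{-c δ √(Nη)}`. -/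
theorem stmt_0 :
    ∃ c₁ : ℝ, 0 < c₁ ∧
    ∀ κ δ₀ D D' : ℝ, 0 < κ →
    ∃ C c : ℝ, 0 < C ∧ 0 < c ∧
    ∀ (N : ℕ) (Ω : Type) (_ : MeasurableSpace Ω) (P : Measure Ω)
      (H : Ω → Matrix (Fin N) (Fin N) ℂ) (ν : Measure ℂ) (ν' : Measure ℝ),
      2 ≤ N →
      IsWignerMatrix P N H ν ν' →
      CondC1 ν ν' δ₀ D D' →
      ∀ E : ℝ, E ∈ Set.Icc (-2 + κ) (2 - κ) →
      ∀ δ η : ℝ, 0 < δ → δ ≤ c₁ * κ →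
        (300 / (Real.pi * rhoSC E)) / N ≤ η → η ≤ 1 →
        P {ω | δ ≤ ‖stTrans (H ω) ((E : ℂ) + η * Complex.I)
            - mSC ((E : ℂ) + η * Complex.I)‖}
          ≤ ENNReal.ofReal (C * Real.exp (-(c * δ * Real.sqrt (N * η)))) := by
  refine ⟨1, one_pos, fun κ δ₀ D D' hκ => ?_⟩
  by_cases hδ₀ : 0 < δ₀
  swap
  · exact ⟨1, 1, one_pos, one_pos, fun N Ω _ P H ν ν' _ _ hC => absurd hC.1 hδ₀⟩
  by_cases hD : 1 ≤ D
  swap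
  · refine ⟨1, 1, one_pos, one_pos, fun N Ω _ P H ν ν' hN hW hC => ?_⟩
    obtain ⟨_, _, h, _⟩ := reduction (by omega) hW hC
    exact absurd h hD
  have hCSG := CSG_ge hδ₀ hD
  set c : ℝ := min (δ₀ / 8) (1 / (2 * CSG δ₀ D)) with hc
  have hc0 : 0 < c := lt_min (by positivity) (by positivity)
  have hcC : CSG δ₀ D * c ≤ 1 / 2 := by
    calc CSG δ₀ D * c ≤ CSG δ₀ D * (1 / (2 * CSG δ₀ D)) := by gcongr; exact min_le_right _ _
      _ = 1 / 2 := by field_simp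
  set Kinf : ℝ≥0∞ := ee (c / 20) * (ee (9 * (c / 20) ^ 2 / (4 * δ₀)) * ENNReal.ofReal D' + 4 * (1 + 3 * ee 1)) with hKi
  have hKt : Kinf ≠ ⊤ := by
    rw [hKi]
    have h1 := ee_ne_top (c / 20)
    have h2 := ee_ne_top (9 * (c / 20) ^ 2 / (4 * δ₀))
    have h3 := ee_ne_top 1
    finiteness
  set K := Kinf.toReal with hK
  have hK0 : 0 ≤ K := ENNReal.toReal_nonneg
  set a := c / 20 with ha
  have ha0 : 0 < a := by positivity
  set s := √(κ / 50) with hs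
  have hs0 : 0 < s := by positivity
  set C₂ := K * (Cg (a * s / 8) + 43) + 3 with hC₂
  set c₂ := a * s ^ 2 / 64 with hc₂
  have hCg := Cg_pos (show 0 < a * s / 8 by positivity)
  have hC20 : 0 < C₂ := by positivity
  have hc20 : 0 < c₂ := by positivity
  have hCg2 := Cg_pos (show 0 < c₂ * (s / 2) by positivity)
  refine ⟨C₂ * (1 + Cg (c₂ * (s / 2))), c₂ * s / 8, by positivity, by positivity, ?_⟩
  intro N Ω _ P H ν ν' hN2 hW hC E hE δ η hδ hδκ hη hη1
  have hN : 0 < N := by omega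
  have hNr : (0 : ℝ) < N := by exact_mod_cast hN
  have hκ2 : κ ≤ 2 := by linarith [hE.1, hE.2]
  have hM : 1 ≤ N * η := by
    rw [div_le_iff₀ hNr, mul_comm η] at hη
    exact (rho_ge hκ hE).trans hη
  have h0 : 0 < η := by
    by_contra h
    push Not at h
    nlinarith
  obtain ⟨ρ, hρ, _, hmap, haem⟩ := reduction hN hW hC
  have := hρ.prob
  have hEps : EpsExp (Measure.pi ρ) a K := by
    intro E η h1 h2 h3 k
    rw [hK, ENNReal.ofReal_toReal hKt]
    exact eps_exp hN hρ hCSG (by positivity) hδ₀ hc0 (min_le_left _ _) hcC h1 h2 h3 k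
  have hfin := pi_main hN ha0 hK0 hEps hκ hκ2 hE hs hC₂ hc₂ h0 hη1 hM hδ (by linarith)
  refine le_trans (le_of_eq ?_) hfin
  rw [← hmap, Measure.map_apply_of_aemeasurable haem]
  · congr 1
    ext ω
    simp only [Set.mem_ofPred_eq, Set.mem_preimage, dv]
    rw [wig_resc hN (hW.herm ω)]
  · exact measurableSet_le measurable_const ((st_meas _).sub_const _).norm

end
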